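/- Let l ≥ 1 be real, m₁, m₂ ∈ ℝ, and let p ∈ S^{m₁,m₂} vanish on {(x,ξ) : h₀(x,ξ) ≤ E₀} for some E₀ > V(0). Extend ⟨p⟩ by 0 for E ≤ V(0). Then there exists χ ∈ S^{m₁+[m₂]−l+1,0} with ∂_x χ ∈ S^{m₁+[m₂]−l,0}, vanishing on {(x,ξ) : h₀(x,ξ) ≤ E₀′} for some E₀′ > V(0), such that the homological equation p(x,ξ) + {h₀;χ}(x,ξ) = ⟨p⟩(h₀(x,ξ)) holds for all (x,ξ) ∈ ℝ². -/

import Mathlib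

open Real MeasureTheory intervalIntegral

noncomputable section

/-- Japanese bracket `⟨x⟩ = √(1+x²)`. -/
def jap (x : ℝ) : ℝ := Real.sqrt (1 + x ^ 2)

/-- The weight `λ(x,ξ) = (1+ξ²+|x|^{2l})^{1/(2l)}`. -/
def lam (l x ξ : ℝ) : ℝ := (1 + ξ ^ 2 + |x| ^ (2 * l)) ^ (1 / (2 * l))

/-- The symbol class `S^{m₁,m₂}`:  `g ∈ C^∞(ℝ²)` with
`|∂_ξ^{k₁}∂_x^{k₂} g(x,ξ)| ≤ C λ(x,ξ)^{m₁-k₁ l} ⟨x⟩^{m₂-k₂}`. -/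
def IsSymbol (l m₁ m₂ : ℝ) (g : ℝ → ℝ → ℝ) : Prop :=
  ContDiff ℝ (⊤ : ℕ∞) (fun q : ℝ × ℝ => g q.1 q.2) ∧
  ∀ k₁ k₂ : ℕ, ∃ C : ℝ, ∀ x ξ : ℝ,
    |iteratedDeriv k₁ (fun ξ' => iteratedDeriv k₂ (fun x' => g x' ξ') x) ξ|
      ≤ C * lam l x ξ ^ (m₁ - (k₁ : ℝ) * l) * jap x ^ (m₂ - (k₂ : ℝ))

/-- The standing assumptions on the potential `V`: it is `C^∞`, even, has no critical
points away from `0`, satisfies the symbol bounds `|∂_x^k V| ≤ C_k ⟨x⟩^{2l-k}`, and admits an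
asymptotic expansion `V(x) ∼ |x|^{2l} + Σ_{j≥1} V_{2l-2j}(x)` with `V_{2l-2j}` smooth away
from zero and positively homogeneous of degree `2l-2j`. -/
structure GoodPotential (l : ℝ) (V : ℝ → ℝ) : Prop where
  smooth : ContDiff ℝ (⊤ : ℕ∞) V
  even : ∀ x : ℝ, V (-x) = V x
  deriv_ne : ∀ x : ℝ, x ≠ 0 → deriv V x ≠ 0
  growth : ∀ k : ℕ, ∃ C : ℝ, ∀ x : ℝ, |iteratedDeriv k V x| ≤ C * jap x ^ (2 * l - (k : ℝ))
  expansion : ∃ Vh : ℕ → ℝ → ℝ,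
    (∀ j : ℕ, 1 ≤ j →
      ContDiffOn ℝ (⊤ : ℕ∞) (Vh j) {x : ℝ | x ≠ 0} ∧
      ∀ ρ : ℝ, 0 < ρ → ∀ x : ℝ, Vh j (ρ * x) = ρ ^ (2 * l - 2 * (j : ℝ)) * Vh j x) ∧
    ∀ N k : ℕ, ∃ C R : ℝ, ∀ x : ℝ, R ≤ |x| →
      |iteratedDeriv k (fun y => V y - |y| ^ (2 * l) - ∑ j ∈ Finset.Icc 1 N, Vh j y) x|
        ≤ C * |x| ^ (2 * l - 2 * ((N : ℝ) + 1) - (k : ℝ))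

/-- `qM` is the turning point function: the unique positive solution of `V(q_M(E)) = E`
for `E > V 0`. -/
def IsTurningPoint (V qM : ℝ → ℝ) : Prop :=
  ∀ E : ℝ, V 0 < E →
    0 < qM E ∧ V (qM E) = E ∧ ∀ q : ℝ, 0 < q → V q = E → q = qM E

/-- The period `T(E) = 4∫₀^{q_M(E)} dq/√(E-V(q))`. -/
def period (V qM : ℝ → ℝ) (E : ℝ) : ℝ :=
  4 * ∫ q in (0:ℝ)..(qM E), (Real.sqrt (E - V q))⁻¹

/-- The orbit average
`⟨p⟩(E) = (1/T(E)) ∫_{-q_M}^{q_M} [p(q,√(E-V q)) + p(q,-√(E-V q))]/√(E-V q) dq`. -/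
def orbitAvg (V qM : ℝ → ℝ) (p : ℝ → ℝ → ℝ) (E : ℝ) : ℝ :=
  (period V qM E)⁻¹ *
    ∫ q in (-(qM E))..(qM E),
      (p q (Real.sqrt (E - V q)) + p q (-Real.sqrt (E - V q))) / Real.sqrt (E - V q)

/-- The Poisson bracket `{a;b} = -∂_ξa ∂_xb + ∂_ξb ∂_xa`. -/
def pbr (a b : ℝ → ℝ → ℝ) (x ξ : ℝ) : ℝ :=
  -(deriv (fun ξ' => a x ξ') ξ) * (deriv (fun x' => b x' ξ) x)
    + (deriv (fun ξ' => b x ξ') ξ) * (deriv (fun x' => a x' ξ) x)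

/-! ### Partial derivatives of functions of two real variables -/

/-- Smoothness of a function of two real variables in curried form. -/
def Smooth₂ (g : ℝ → ℝ → ℝ) : Prop := ContDiff ℝ (⊤ : ℕ∞) (fun q : ℝ × ℝ => g q.1 q.2)

/-- The partial derivative `∂_x g`. -/
def dX (g : ℝ → ℝ → ℝ) (x ξ : ℝ) : ℝ := deriv (fun x' => g x' ξ) x

/-- The partial derivative `∂_ξ g`. -/
def dXi (g : ℝ → ℝ → ℝ) (x ξ : ℝ) : ℝ := deriv (fun ξ' => g x ξ') ξ

/-- The linear form `(a, b)` on `ℝ²`. -/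
def pairCLM (a b : ℝ) : ℝ × ℝ →L[ℝ] ℝ :=
  a • ContinuousLinearMap.fst ℝ ℝ ℝ + b • ContinuousLinearMap.snd ℝ ℝ ℝ

@[simp] lemma pairCLM_apply (a b : ℝ) (v : ℝ × ℝ) : pairCLM a b v = a * v.1 + b * v.2 := by
  simp [pairCLM]

lemma HasFDerivAt.hasDerivAt_fst {g : ℝ → ℝ → ℝ} {a b x ξ : ℝ}
    (h : HasFDerivAt (fun q : ℝ × ℝ => g q.1 q.2) (pairCLM a b) (x, ξ)) :
    HasDerivAt (fun x' => g x' ξ) a x := by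
  have := h.comp_hasDerivAt x ((hasDerivAt_id x).prodMk (hasDerivAt_const x ξ))
  simpa [Function.comp_def] using this

lemma HasFDerivAt.hasDerivAt_snd {g : ℝ → ℝ → ℝ} {a b x ξ : ℝ}
    (h : HasFDerivAt (fun q : ℝ × ℝ => g q.1 q.2) (pairCLM a b) (x, ξ)) :
    HasDerivAt (fun ξ' => g x ξ') b ξ := by
  have := h.comp_hasDerivAt ξ ((hasDerivAt_const ξ x).prodMk (hasDerivAt_id ξ))
  simpa [Function.comp_def] using this

lemma Smooth₂.differentiable {g : ℝ → ℝ → ℝ} (hg : Smooth₂ g) :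
    Differentiable ℝ (fun q : ℝ × ℝ => g q.1 q.2) :=
  ContDiff.differentiable hg (by simp)

lemma Smooth₂.continuous {g : ℝ → ℝ → ℝ} (hg : Smooth₂ g) :
    Continuous (fun q : ℝ × ℝ => g q.1 q.2) :=
  ContDiff.continuous hg

lemma Smooth₂.hasDerivAt_fst {g : ℝ → ℝ → ℝ} (hg : Smooth₂ g) (x ξ : ℝ) :
    HasDerivAt (fun x' => g x' ξ) (dX g x ξ) x := by
  have h : DifferentiableAt ℝ (fun x' => g x' ξ) x :=
    (hg.differentiable (x, ξ)).comp (f := fun x' : ℝ => (x', ξ)) x (by fun_prop)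
  exact h.hasDerivAt

lemma Smooth₂.hasDerivAt_snd {g : ℝ → ℝ → ℝ} (hg : Smooth₂ g) (x ξ : ℝ) :
    HasDerivAt (fun ξ' => g x ξ') (dXi g x ξ) ξ := by
  have h : DifferentiableAt ℝ (fun ξ' => g x ξ') ξ :=
    (hg.differentiable (x, ξ)).comp (f := fun ξ' : ℝ => (x, ξ')) ξ (by fun_prop)
  exact h.hasDerivAt

lemma Smooth₂.dX_eq {g : ℝ → ℝ → ℝ} (hg : Smooth₂ g) (x ξ : ℝ) :
    dX g x ξ = fderiv ℝ (fun q : ℝ × ℝ => g q.1 q.2) (x, ξ) (1, 0) := by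
  have := (hg.differentiable (x, ξ)).hasFDerivAt.comp_hasDerivAt x
    ((hasDerivAt_id x).prodMk (hasDerivAt_const x ξ))
  exact this.deriv

lemma Smooth₂.dXi_eq {g : ℝ → ℝ → ℝ} (hg : Smooth₂ g) (x ξ : ℝ) :
    dXi g x ξ = fderiv ℝ (fun q : ℝ × ℝ => g q.1 q.2) (x, ξ) (0, 1) := by
  have := (hg.differentiable (x, ξ)).hasFDerivAt.comp_hasDerivAt ξ
    ((hasDerivAt_const ξ x).prodMk (hasDerivAt_id ξ))
  exact this.deriv

lemma Smooth₂.hasFDerivAt {g : ℝ → ℝ → ℝ} (hg : Smooth₂ g) (x ξ : ℝ) :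
    HasFDerivAt (fun q : ℝ × ℝ => g q.1 q.2) (pairCLM (dX g x ξ) (dXi g x ξ)) (x, ξ) := by
  have h := (hg.differentiable (x, ξ)).hasFDerivAt
  convert h using 1
  ext <;> simp [hg.dX_eq, hg.dXi_eq]

lemma Smooth₂.dX {g : ℝ → ℝ → ℝ} (hg : Smooth₂ g) : Smooth₂ (dX g) := by
  have h : ContDiff ℝ (⊤ : ℕ∞) (fderiv ℝ (fun q : ℝ × ℝ => g q.1 q.2)) :=
    (contDiff_infty_iff_fderiv.1 hg).2
  have h2 := h.clm_apply (contDiff_const (c := ((1 : ℝ), (0 : ℝ))))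
  unfold Smooth₂
  simpa only [hg.dX_eq] using h2

lemma Smooth₂.dXi {g : ℝ → ℝ → ℝ} (hg : Smooth₂ g) : Smooth₂ (dXi g) := by
  have h : ContDiff ℝ (⊤ : ℕ∞) (fderiv ℝ (fun q : ℝ × ℝ => g q.1 q.2)) :=
    (contDiff_infty_iff_fderiv.1 hg).2
  have h2 := h.clm_apply (contDiff_const (c := ((0 : ℝ), (1 : ℝ))))
  unfold Smooth₂
  simpa only [hg.dXi_eq] using h2

lemma Smooth₂.dX_dXi_comm {g : ℝ → ℝ → ℝ} (hg : Smooth₂ g) :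
    _root_.dX (_root_.dXi g) = _root_.dXi (_root_.dX g) := by
  have hs : ∀ q : ℝ × ℝ, IsSymmSndFDerivAt ℝ (fun q : ℝ × ℝ => g q.1 q.2) q := fun q =>
    ContDiffAt.isSymmSndFDerivAt (n := (⊤ : ℕ∞)) (ContDiff.contDiffAt hg) (by
      simp only [minSmoothness_of_isRCLikeNormedField]
      exact WithTop.coe_le_coe.2 (le_top : (2 : ℕ∞) ≤ ⊤))
  have h : Differentiable ℝ (fderiv ℝ (fun q : ℝ × ℝ => g q.1 q.2)) :=
    ContDiff.differentiable (contDiff_infty_iff_fderiv.1 hg).2 (by simp)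
  have key : ∀ (v : ℝ × ℝ) (q w : ℝ × ℝ),
      fderiv ℝ (fun q : ℝ × ℝ => fderiv ℝ (fun q : ℝ × ℝ => g q.1 q.2) q v) q w
        = fderiv ℝ (fderiv ℝ (fun q : ℝ × ℝ => g q.1 q.2)) q w v := by
    intro v q w
    have := ((h q).hasFDerivAt.clm_apply (hasFDerivAt_const v q)).fderiv
    rw [this]; simp
  funext x ξ
  rw [hg.dXi.dX_eq, hg.dX.dXi_eq]
  have e1 : (fun q : ℝ × ℝ => _root_.dXi g q.1 q.2)
      = fun q => fderiv ℝ (fun q : ℝ × ℝ => g q.1 q.2) q (0, 1) :=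
    funext fun q => hg.dXi_eq q.1 q.2
  have e2 : (fun q : ℝ × ℝ => _root_.dX g q.1 q.2)
      = fun q => fderiv ℝ (fun q : ℝ × ℝ => g q.1 q.2) q (1, 0) :=
    funext fun q => hg.dX_eq q.1 q.2
  rw [e1, e2, key, key]
  exact hs (x, ξ) _ _

lemma Smooth₂.add {g h : ℝ → ℝ → ℝ} (hg : Smooth₂ g) (hh : Smooth₂ h) :
    Smooth₂ (fun x ξ => g x ξ + h x ξ) := ContDiff.add hg hh

lemma Smooth₂.mul {g h : ℝ → ℝ → ℝ} (hg : Smooth₂ g) (hh : Smooth₂ h) :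
    Smooth₂ (fun x ξ => g x ξ * h x ξ) := ContDiff.mul hg hh

lemma Smooth₂.inv {g : ℝ → ℝ → ℝ} (hg : Smooth₂ g) (h0 : ∀ x ξ, g x ξ ≠ 0) :
    Smooth₂ (fun x ξ => (g x ξ)⁻¹) := ContDiff.inv hg fun q => h0 q.1 q.2

lemma dX_add {g h : ℝ → ℝ → ℝ} (hg : Smooth₂ g) (hh : Smooth₂ h) :
    dX (fun x ξ => g x ξ + h x ξ) = fun x ξ => dX g x ξ + dX h x ξ := by
  funext x ξ; exact ((hg.hasDerivAt_fst x ξ).add (hh.hasDerivAt_fst x ξ)).deriv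

lemma dXi_add {g h : ℝ → ℝ → ℝ} (hg : Smooth₂ g) (hh : Smooth₂ h) :
    dXi (fun x ξ => g x ξ + h x ξ) = fun x ξ => dXi g x ξ + dXi h x ξ := by
  funext x ξ; exact ((hg.hasDerivAt_snd x ξ).add (hh.hasDerivAt_snd x ξ)).deriv

lemma dX_mul {g h : ℝ → ℝ → ℝ} (hg : Smooth₂ g) (hh : Smooth₂ h) :
    dX (fun x ξ => g x ξ * h x ξ) = fun x ξ => dX g x ξ * h x ξ + g x ξ * dX h x ξ := by
  funext x ξ; exact ((hg.hasDerivAt_fst x ξ).mul (hh.hasDerivAt_fst x ξ)).deriv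

lemma dXi_mul {g h : ℝ → ℝ → ℝ} (hg : Smooth₂ g) (hh : Smooth₂ h) :
    dXi (fun x ξ => g x ξ * h x ξ) = fun x ξ => dXi g x ξ * h x ξ + g x ξ * dXi h x ξ := by
  funext x ξ; exact ((hg.hasDerivAt_snd x ξ).mul (hh.hasDerivAt_snd x ξ)).deriv

lemma dX_inv {g : ℝ → ℝ → ℝ} (hg : Smooth₂ g) (h0 : ∀ x ξ, g x ξ ≠ 0) :
    dX (fun x ξ => (g x ξ)⁻¹) = fun x ξ => (-1 * dX g x ξ) * ((g x ξ)⁻¹ * (g x ξ)⁻¹) := by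
  funext x ξ
  have := ((hg.hasDerivAt_fst x ξ).inv (h0 x ξ)).deriv
  refine this.trans ?_
  field_simp

lemma dXi_inv {g : ℝ → ℝ → ℝ} (hg : Smooth₂ g) (h0 : ∀ x ξ, g x ξ ≠ 0) :
    dXi (fun x ξ => (g x ξ)⁻¹) = fun x ξ => (-1 * dXi g x ξ) * ((g x ξ)⁻¹ * (g x ξ)⁻¹) := by
  funext x ξ
  have := ((hg.hasDerivAt_snd x ξ).inv (h0 x ξ)).deriv
  refine this.trans ?_
  field_simp

lemma smooth₂_const (c : ℝ) : Smooth₂ (fun _ _ => c) := contDiff_const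

lemma smooth₂_of_hasFDerivAt_rec {u α β : ℕ → ℝ → ℝ → ℝ} {a b : ℝ → ℝ → ℝ}
    (ha : Smooth₂ a) (hb : Smooth₂ b) (hα : ∀ k, Smooth₂ (α k)) (hβ : ∀ k, Smooth₂ (β k))
    (hu : ∀ k x ξ, HasFDerivAt (fun q : ℝ × ℝ => u k q.1 q.2)
      (pairCLM (α k x ξ + a x ξ * u (k + 1) x ξ) (β k x ξ + b x ξ * u (k + 1) x ξ)) (x, ξ)) :
    ∀ k, Smooth₂ (u k) := by
  have key : ∀ n : ℕ, ∀ k, ContDiff ℝ n (fun q : ℝ × ℝ => u k q.1 q.2) := by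
    intro n
    induction n with
    | zero =>
      intro k
      exact contDiff_zero.2 (continuous_iff_continuousAt.2 fun q => (hu k q.1 q.2).continuousAt)
    | succ n ih =>
      intro k
      have hn : ∀ {g : ℝ → ℝ → ℝ}, Smooth₂ g → ContDiff ℝ n (fun q : ℝ × ℝ => g q.1 q.2) :=
        fun h => ContDiff.of_le h (mod_cast le_top)
      push_cast
      rw [contDiff_succ_iff_hasFDerivAt]
      refine ⟨fun q => pairCLM (α k q.1 q.2 + a q.1 q.2 * u (k + 1) q.1 q.2)
        (β k q.1 q.2 + b q.1 q.2 * u (k + 1) q.1 q.2), ?_, fun q => hu k q.1 q.2⟩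
      unfold pairCLM
      exact (((hn (hα k)).add ((hn ha).mul (ih _))).smul contDiff_const).add
        (((hn (hβ k)).add ((hn hb).mul (ih _))).smul contDiff_const)
  exact fun k => contDiff_infty.2 fun n => key n k

/-! ### Symbol classes -/

lemma one_le_jap (x : ℝ) : 1 ≤ jap x := by
  unfold jap; rw [Real.one_le_sqrt]; nlinarith [sq_nonneg x]

lemma jap_pos (x : ℝ) : 0 < jap x := lt_of_lt_of_le one_pos (one_le_jap x)

lemma abs_le_jap (x : ℝ) : |x| ≤ jap x := by
  unfold jap; apply Real.abs_le_sqrt; linarith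

lemma continuous_jap : Continuous jap := by unfold jap; fun_prop

lemma one_le_lam_base (l x ξ : ℝ) : 1 ≤ 1 + ξ ^ 2 + |x| ^ (2 * l) := by
  have := Real.rpow_nonneg (abs_nonneg x) (2 * l)
  nlinarith [sq_nonneg ξ]

lemma one_le_lam {l : ℝ} (hl : 1 ≤ l) (x ξ : ℝ) : 1 ≤ lam l x ξ :=
  Real.one_le_rpow (one_le_lam_base l x ξ) (by positivity)

lemma lam_pos {l : ℝ} (hl : 1 ≤ l) (x ξ : ℝ) : 0 < lam l x ξ :=
  lt_of_lt_of_le one_pos (one_le_lam hl x ξ)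

lemma lam_rpow_two_mul {l : ℝ} (hl : 1 ≤ l) (x ξ : ℝ) :
    lam l x ξ ^ (2 * l) = 1 + ξ ^ 2 + |x| ^ (2 * l) := by
  unfold lam
  rw [← Real.rpow_mul (by linarith [one_le_lam_base l x ξ])]
  rw [one_div_mul_cancel (by linarith), Real.rpow_one]

lemma abs_le_lam {l : ℝ} (hl : 1 ≤ l) (x ξ : ℝ) : |x| ≤ lam l x ξ := by
  have h : |x| ^ (2 * l) ≤ lam l x ξ ^ (2 * l) := by
    rw [lam_rpow_two_mul hl]; nlinarith [sq_nonneg ξ]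
  exact (Real.rpow_le_rpow_iff (abs_nonneg x) (lam_pos hl x ξ).le (by linarith)).1 h

lemma sq_le_lam_rpow {l : ℝ} (hl : 1 ≤ l) (x ξ : ℝ) : ξ ^ 2 ≤ lam l x ξ ^ (2 * l) := by
  rw [lam_rpow_two_mul hl]
  have := Real.rpow_nonneg (abs_nonneg x) (2 * l)
  linarith

lemma abs_le_lam_rpow {l : ℝ} (hl : 1 ≤ l) (x ξ : ℝ) : |ξ| ≤ lam l x ξ ^ l := by
  refine abs_le_of_sq_le_sq ?_ (Real.rpow_nonneg (lam_pos hl x ξ).le _)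
  rw [← Real.rpow_mul_natCast (lam_pos hl x ξ).le]
  have := sq_le_lam_rpow hl x ξ
  rwa [mul_comm] at this

lemma jap_le_lam {l : ℝ} (hl : 1 ≤ l) (x ξ : ℝ) : jap x ≤ 2 * lam l x ξ := by
  unfold jap
  rw [Real.sqrt_le_left (by linarith [lam_pos hl x ξ])]
  have h1 := abs_le_lam hl x ξ
  have h2 := one_le_lam hl x ξ
  nlinarith [abs_nonneg x, sq_abs x]

lemma continuous_lam {l : ℝ} (hl : 1 ≤ l) : Continuous (fun q : ℝ × ℝ => lam l q.1 q.2) := by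
  unfold lam
  refine Continuous.rpow_const ?_ fun q => Or.inl (by linarith [one_le_lam_base l q.1 q.2])
  refine (by fun_prop : Continuous fun q : ℝ × ℝ => 1 + q.2 ^ 2).add ?_
  exact Continuous.rpow_const (by fun_prop) fun q => Or.inr (by linarith)

/-- The weight `λ^m ⟨x⟩^n` defining the symbol class `S^{m,n}`. -/
def wt (l m n x ξ : ℝ) : ℝ := lam l x ξ ^ m * jap x ^ n

lemma wt_pos {l : ℝ} (hl : 1 ≤ l) (m n x ξ : ℝ) : 0 < wt l m n x ξ :=
  mul_pos (Real.rpow_pos_of_pos (lam_pos hl x ξ) _) (Real.rpow_pos_of_pos (jap_pos x) _)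

lemma wt_mul {l : ℝ} (hl : 1 ≤ l) (m n m' n' x ξ : ℝ) :
    wt l m n x ξ * wt l m' n' x ξ = wt l (m + m') (n + n') x ξ := by
  unfold wt
  rw [Real.rpow_add (lam_pos hl x ξ), Real.rpow_add (jap_pos x)]; ring

lemma wt_inv {l : ℝ} (hl : 1 ≤ l) (m n x ξ : ℝ) :
    (wt l m n x ξ)⁻¹ = wt l (-m) (-n) x ξ := by
  unfold wt
  rw [Real.rpow_neg (lam_pos hl x ξ).le, Real.rpow_neg (jap_pos x).le, mul_inv]

lemma continuous_wt {l : ℝ} (hl : 1 ≤ l) (m n : ℝ) :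
    Continuous (fun q : ℝ × ℝ => wt l m n q.1 q.2) := by
  unfold wt
  refine ((continuous_lam hl).rpow_const fun q => Or.inl (lam_pos hl _ _).ne').mul ?_
  exact (continuous_jap.comp continuous_fst).rpow_const fun q => Or.inl (jap_pos _).ne'

lemma wt_mono {l : ℝ} (hl : 1 ≤ l) {m n m' n' : ℝ} (h1 : m ≤ m') (h2 : m + n ≤ m' + n') :
    ∃ C, 0 < C ∧ ∀ x ξ, wt l m n x ξ ≤ C * wt l m' n' x ξ := by
  rcases le_total n n' with h | h
  · refine ⟨1, one_pos, fun x ξ => ?_⟩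
    rw [one_mul]; unfold wt
    exact mul_le_mul (Real.rpow_le_rpow_of_exponent_le (one_le_lam hl x ξ) h1)
      (Real.rpow_le_rpow_of_exponent_le (one_le_jap x) h)
      (Real.rpow_nonneg (jap_pos x).le _) (Real.rpow_nonneg (lam_pos hl x ξ).le _)
  · refine ⟨2 ^ (n - n'), by positivity, fun x ξ => ?_⟩
    have hL := lam_pos hl x ξ
    have hJ := jap_pos x
    have e1 : jap x ^ n ≤ 2 ^ (n - n') * lam l x ξ ^ (n - n') * jap x ^ n' := by
      have : jap x ^ n = jap x ^ (n - n') * jap x ^ n' := by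
        rw [← Real.rpow_add hJ]; congr 1; ring
      rw [this, ← Real.mul_rpow zero_le_two hL.le]
      exact mul_le_mul_of_nonneg_right
        (Real.rpow_le_rpow hJ.le (jap_le_lam hl x ξ) (by linarith)) (Real.rpow_nonneg hJ.le _)
    have e2 : lam l x ξ ^ (m + (n - n')) ≤ lam l x ξ ^ m' :=
      Real.rpow_le_rpow_of_exponent_le (one_le_lam hl x ξ) (by linarith)
    unfold wt
    calc lam l x ξ ^ m * jap x ^ n
        ≤ lam l x ξ ^ m * (2 ^ (n - n') * lam l x ξ ^ (n - n') * jap x ^ n') := by gcongr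
      _ = 2 ^ (n - n') * (lam l x ξ ^ (m + (n - n')) * jap x ^ n') := by
          rw [Real.rpow_add hL]; ring
      _ ≤ 2 ^ (n - n') * (lam l x ξ ^ m' * jap x ^ n') := by gcongr

/-- The estimates of the class `S^{m,n}` for all mixed partial derivatives up to order `k`. -/
def SymBound (l : ℝ) : ℕ → ℝ → ℝ → (ℝ → ℝ → ℝ) → Prop
  | 0, m, n, g => ∃ C, ∀ x ξ, |g x ξ| ≤ C * wt l m n x ξ
  | k + 1, m, n, g => (∃ C, ∀ x ξ, |g x ξ| ≤ C * wt l m n x ξ) ∧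
      SymBound l k m (n - 1) (dX g) ∧ SymBound l k (m - l) n (dXi g)

lemma SymBound.bound {l : ℝ} {k : ℕ} {m n : ℝ} {g : ℝ → ℝ → ℝ} (h : SymBound l k m n g) :
    ∃ C, ∀ x ξ, |g x ξ| ≤ C * wt l m n x ξ := by
  cases k with
  | zero => exact h
  | succ k => exact h.1

lemma SymBound.pred {l : ℝ} {k : ℕ} {m n : ℝ} {g : ℝ → ℝ → ℝ} (h : SymBound l (k + 1) m n g) :
    SymBound l k m n g := by
  induction k generalizing m n g with
  | zero => exact h.1
  | succ k ih => exact ⟨h.1, ih h.2.1, ih h.2.2⟩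

lemma SymBound.mono {l : ℝ} (hl : 1 ≤ l) {k : ℕ} {m n m' n' : ℝ} {g : ℝ → ℝ → ℝ}
    (h : SymBound l k m n g) (h1 : m ≤ m') (h2 : m + n ≤ m' + n') : SymBound l k m' n' g := by
  have hb : ∀ {m n m' n' : ℝ} {g : ℝ → ℝ → ℝ}, m ≤ m' → m + n ≤ m' + n' →
      (∃ C, ∀ x ξ, |g x ξ| ≤ C * wt l m n x ξ) → ∃ C, ∀ x ξ, |g x ξ| ≤ C * wt l m' n' x ξ := by
    rintro m n m' n' g h1 h2 ⟨C, hC⟩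
    obtain ⟨D, hD, hw⟩ := wt_mono hl h1 h2
    refine ⟨|C| * D, fun x ξ => (hC x ξ).trans ?_⟩
    calc C * wt l m n x ξ ≤ |C| * wt l m n x ξ :=
          mul_le_mul_of_nonneg_right (le_abs_self C) (wt_pos hl _ _ _ _).le
      _ ≤ |C| * (D * wt l m' n' x ξ) := mul_le_mul_of_nonneg_left (hw x ξ) (abs_nonneg C)
      _ = _ := by ring
  induction k generalizing m n m' n' g with
  | zero => exact hb h1 h2 h
  | succ k ih =>
    exact ⟨hb h1 h2 h.1, ih h.2.1 h1 (by linarith), ih h.2.2 (by linarith) (by linarith)⟩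

lemma SymBound.add {l : ℝ} {k : ℕ} {m n : ℝ} {g h : ℝ → ℝ → ℝ} (hg : SymBound l k m n g)
    (hh : SymBound l k m n h) (sg : Smooth₂ g) (sh : Smooth₂ h) :
    SymBound l k m n (fun x ξ => g x ξ + h x ξ) := by
  have hb : ∀ {m n : ℝ} {g h : ℝ → ℝ → ℝ}, (∃ C, ∀ x ξ, |g x ξ| ≤ C * wt l m n x ξ) →
      (∃ C, ∀ x ξ, |h x ξ| ≤ C * wt l m n x ξ) →
      ∃ C, ∀ x ξ, |g x ξ + h x ξ| ≤ C * wt l m n x ξ := by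
    rintro m n g h ⟨C, hC⟩ ⟨D, hD⟩
    exact ⟨C + D, fun x ξ => (abs_add_le _ _).trans (by linarith [hC x ξ, hD x ξ])⟩
  induction k generalizing m n g h with
  | zero => exact hb hg hh
  | succ k ih =>
    refine ⟨hb hg.1 hh.1, ?_, ?_⟩
    · rw [dX_add sg sh]; exact ih hg.2.1 hh.2.1 sg.dX sh.dX
    · rw [dXi_add sg sh]; exact ih hg.2.2 hh.2.2 sg.dXi sh.dXi

lemma SymBound.mul {l : ℝ} (hl : 1 ≤ l) {k : ℕ} {m n m' n' : ℝ} {g h : ℝ → ℝ → ℝ}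
    (hg : SymBound l k m n g) (hh : SymBound l k m' n' h) (sg : Smooth₂ g) (sh : Smooth₂ h) :
    SymBound l k (m + m') (n + n') (fun x ξ => g x ξ * h x ξ) := by
  have hb : ∀ {m n m' n' : ℝ} {g h : ℝ → ℝ → ℝ}, (∃ C, ∀ x ξ, |g x ξ| ≤ C * wt l m n x ξ) →
      (∃ C, ∀ x ξ, |h x ξ| ≤ C * wt l m' n' x ξ) →
      ∃ C, ∀ x ξ, |g x ξ * h x ξ| ≤ C * wt l (m + m') (n + n') x ξ := by
    rintro m n m' n' g h ⟨C, hC⟩ ⟨D, hD⟩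
    refine ⟨C * D, fun x ξ => ?_⟩
    rw [abs_mul, ← wt_mul hl]
    calc |g x ξ| * |h x ξ| ≤ (C * wt l m n x ξ) * (D * wt l m' n' x ξ) :=
          mul_le_mul (hC x ξ) (hD x ξ) (abs_nonneg _) ((abs_nonneg _).trans (hC x ξ))
      _ = _ := by ring
  induction k generalizing m n m' n' g h with
  | zero => exact hb hg hh
  | succ k ih =>
    refine ⟨hb hg.1 hh.1, ?_, ?_⟩
    · rw [dX_mul sg sh]
      refine SymBound.add ?_ ?_ (sg.dX.mul sh) (sg.mul sh.dX)
      · exact (ih hg.2.1 hh.pred sg.dX sh).mono hl (by linarith) (by linarith)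
      · exact (ih hg.pred hh.2.1 sg sh.dX).mono hl (by linarith) (by linarith)
    · rw [dXi_mul sg sh]
      refine SymBound.add ?_ ?_ (sg.dXi.mul sh) (sg.mul sh.dXi)
      · exact (ih hg.2.2 hh.pred sg.dXi sh).mono hl (by linarith) (by linarith)
      · exact (ih hg.pred hh.2.2 sg sh.dXi).mono hl (by linarith) (by linarith)

lemma dX_const (c : ℝ) : dX (fun _ _ => c) = fun _ _ => 0 := by
  funext x ξ; simp [dX]

lemma dXi_const (c : ℝ) : dXi (fun _ _ => c) = fun _ _ => 0 := by
  funext x ξ; simp [dXi]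

lemma sym_zero {l : ℝ} (k : ℕ) (m n : ℝ) : SymBound l k m n (fun _ _ => 0) := by
  induction k generalizing m n with
  | zero => exact ⟨0, fun x ξ => by simp⟩
  | succ k ih => exact ⟨⟨0, fun x ξ => by simp⟩, by rw [dX_const]; exact ih _ _,
      by rw [dXi_const]; exact ih _ _⟩

lemma sym_const {l : ℝ} (k : ℕ) (c : ℝ) : SymBound l k 0 0 (fun _ _ => c) := by
  cases k with
  | zero => exact ⟨|c|, fun x ξ => by simp [wt]⟩
  | succ k => exact ⟨⟨|c|, fun x ξ => by simp [wt]⟩, by rw [dX_const]; exact sym_zero _ _ _,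
      by rw [dXi_const]; exact sym_zero _ _ _⟩

lemma SymBound.inv {l : ℝ} (hl : 1 ≤ l) {k : ℕ} {m n c : ℝ} {g : ℝ → ℝ → ℝ}
    (hg : SymBound l k m n g) (sg : Smooth₂ g) (hc : 0 < c)
    (hlow : ∀ x ξ, c * wt l m n x ξ ≤ g x ξ) :
    SymBound l k (-m) (-n) (fun x ξ => (g x ξ)⁻¹) := by
  have hpos : ∀ x ξ, 0 < g x ξ := fun x ξ =>
    lt_of_lt_of_le (mul_pos hc (wt_pos hl _ _ _ _)) (hlow x ξ)
  have hne : ∀ x ξ, g x ξ ≠ 0 := fun x ξ => (hpos x ξ).ne'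
  have hb : ∃ C, ∀ x ξ, |(g x ξ)⁻¹| ≤ C * wt l (-m) (-n) x ξ := by
    refine ⟨c⁻¹, fun x ξ => ?_⟩
    rw [abs_of_pos (inv_pos.2 (hpos x ξ)), ← wt_inv hl, ← mul_inv]
    exact inv_anti₀ (mul_pos hc (wt_pos hl _ _ _ _)) (hlow x ξ)
  have si := sg.inv hne
  induction k with
  | zero => exact hb
  | succ k ih =>
    have i := ih hg.pred
    have ii := i.mul hl i si si
    refine ⟨hb, ?_, ?_⟩
    · rw [dX_inv sg hne]
      exact (((sym_const k (-1)).mul hl hg.2.1 (smooth₂_const _) sg.dX).mul hl ii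
        ((smooth₂_const _).mul sg.dX) (si.mul si)).mono hl (by linarith) (by linarith)
    · rw [dXi_inv sg hne]
      exact (((sym_const k (-1)).mul hl hg.2.2 (smooth₂_const _) sg.dXi).mul hl ii
        ((smooth₂_const _).mul sg.dXi) (si.mul si)).mono hl (by linarith) (by linarith)

/-- A smooth function with compact support satisfies all symbol estimates. -/
lemma sym_of_compact_support {l : ℝ} (hl : 1 ≤ l) (k : ℕ) (m n R : ℝ) {g : ℝ → ℝ → ℝ}
    (sg : Smooth₂ g) (hR : ∀ x ξ, R < |x| ∨ R < |ξ| → g x ξ = 0) : SymBound l k m n g := by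
  have hb : ∀ (m n : ℝ) {g : ℝ → ℝ → ℝ}, Smooth₂ g → (∀ x ξ, R < |x| ∨ R < |ξ| → g x ξ = 0) →
      ∃ C, ∀ x ξ, |g x ξ| ≤ C * wt l m n x ξ := by
    intro m n g sg hR
    have hcont : Continuous fun q : ℝ × ℝ => g q.1 q.2 / wt l m n q.1 q.2 :=
      sg.continuous.div (continuous_wt hl m n) fun q => (wt_pos hl _ _ _ _).ne'
    obtain ⟨C, hC⟩ := ((isCompact_Icc (a := -R) (b := R)).prod
      (isCompact_Icc (a := -R) (b := R))).exists_bound_of_continuousOn hcont.continuousOn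
    refine ⟨|C|, fun x ξ => ?_⟩
    have hw := wt_pos hl m n x ξ
    by_cases h : R < |x| ∨ R < |ξ|
    · rw [hR x ξ h, abs_zero]; positivity
    · push Not at h
      have := hC (x, ξ) ⟨abs_le.1 h.1, abs_le.1 h.2⟩
      rw [Real.norm_eq_abs, abs_div, abs_of_pos hw, div_le_iff₀ hw] at this
      exact this.trans (mul_le_mul_of_nonneg_right (le_abs_self C) hw.le)
  have open1 : ∀ x ξ : ℝ, R < |x| ∨ R < |ξ| → ∀ᶠ y in nhds x, R < |y| ∨ R < |ξ| := by
    rintro x ξ (h | h)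
    · exact ((continuous_abs.tendsto x).eventually_const_lt h).mono fun y hy => Or.inl hy
    · exact Filter.Eventually.of_forall fun y => Or.inr h
  have open2 : ∀ x ξ : ℝ, R < |x| ∨ R < |ξ| → ∀ᶠ η in nhds ξ, R < |x| ∨ R < |η| := by
    rintro x ξ (h | h)
    · exact Filter.Eventually.of_forall fun y => Or.inl h
    · exact ((continuous_abs.tendsto ξ).eventually_const_lt h).mono fun y hy => Or.inr hy
  induction k generalizing m n g with
  | zero => exact hb m n sg hR
  | succ k ih =>
    refine ⟨hb m n sg hR, ih _ _ sg.dX fun x ξ h => ?_, ih _ _ sg.dXi fun x ξ h => ?_⟩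
    · have : (fun x' => g x' ξ) =ᶠ[nhds x] fun _ => 0 :=
        (open1 x ξ h).mono fun y hy => hR y ξ hy
      exact this.deriv_eq.trans (by simp)
    · have : (fun ξ' => g x ξ') =ᶠ[nhds ξ] fun _ => 0 :=
        (open2 x ξ h).mono fun y hy => hR x y hy
      exact this.deriv_eq.trans (by simp)

lemma iteratedDeriv_fst_eq (g : ℝ → ℝ → ℝ) (k : ℕ) :
    (fun x ξ => iteratedDeriv k (fun x' => g x' ξ) x) = dX^[k] g := by
  induction k with
  | zero => simp
  | succ k ih =>
    rw [Function.iterate_succ_apply', ← ih]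
    funext x ξ
    rw [iteratedDeriv_succ]; rfl

lemma iteratedDeriv_snd_eq (g : ℝ → ℝ → ℝ) (k : ℕ) :
    (fun x ξ => iteratedDeriv k (fun ξ' => g x ξ') ξ) = dXi^[k] g := by
  induction k with
  | zero => simp
  | succ k ih =>
    rw [Function.iterate_succ_apply', ← ih]
    funext x ξ
    rw [iteratedDeriv_succ]; rfl

lemma iteratedDeriv_mixed_eq (g : ℝ → ℝ → ℝ) (k₁ k₂ : ℕ) (x ξ : ℝ) :
    iteratedDeriv k₁ (fun ξ' => iteratedDeriv k₂ (fun x' => g x' ξ') x) ξ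
      = dXi^[k₁] (dX^[k₂] g) x ξ := by
  rw [← iteratedDeriv_snd_eq, ← iteratedDeriv_fst_eq]

lemma isSymbol_iff_iterate {l m n : ℝ} {g : ℝ → ℝ → ℝ} :
    IsSymbol l m n g ↔ Smooth₂ g ∧ ∀ k₁ k₂ : ℕ, ∃ C, ∀ x ξ,
      |dXi^[k₁] (dX^[k₂] g) x ξ| ≤ C * wt l (m - k₁ * l) (n - k₂) x ξ := by
  simp only [IsSymbol, Smooth₂, iteratedDeriv_mixed_eq, wt, mul_assoc]

lemma Smooth₂.iterate_dX {g : ℝ → ℝ → ℝ} (hg : Smooth₂ g) (k : ℕ) :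
    Smooth₂ (_root_.dX^[k] g) := by
  induction k with
  | zero => exact hg
  | succ k ih => rw [Function.iterate_succ_apply']; exact ih.dX

lemma Smooth₂.iterate_dX_dXi {g : ℝ → ℝ → ℝ} (hg : Smooth₂ g) (k : ℕ) :
    _root_.dX^[k] (_root_.dXi g) = _root_.dXi (_root_.dX^[k] g) := by
  induction k with
  | zero => rfl
  | succ k ih =>
    rw [Function.iterate_succ_apply', ih, Function.iterate_succ_apply', (hg.iterate_dX k).dX_dXi_comm]

lemma IsSymbol.smooth {l m n : ℝ} {g : ℝ → ℝ → ℝ} (h : IsSymbol l m n g) : Smooth₂ g := h.1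

lemma IsSymbol.dX {l m n : ℝ} {g : ℝ → ℝ → ℝ} (h : IsSymbol l m n g) :
    IsSymbol l m (n - 1) (dX g) := by
  rw [isSymbol_iff_iterate] at h ⊢
  refine ⟨h.1.dX, fun k₁ k₂ => ?_⟩
  obtain ⟨C, hC⟩ := h.2 k₁ (k₂ + 1)
  refine ⟨C, fun x ξ => ?_⟩
  have := hC x ξ
  rw [Function.iterate_succ_apply] at this
  convert this using 3
  push_cast; ring

lemma IsSymbol.dXi {l m n : ℝ} {g : ℝ → ℝ → ℝ} (h : IsSymbol l m n g) :
    IsSymbol l (m - l) n (dXi g) := by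
  rw [isSymbol_iff_iterate] at h ⊢
  refine ⟨h.1.dXi, fun k₁ k₂ => ?_⟩
  obtain ⟨C, hC⟩ := h.2 (k₁ + 1) k₂
  refine ⟨C, fun x ξ => ?_⟩
  have := hC x ξ
  rw [Function.iterate_succ_apply] at this
  rw [h.1.iterate_dX_dXi]
  convert this using 3
  push_cast; ring

lemma isSymbol_iff {l m n : ℝ} {g : ℝ → ℝ → ℝ} :
    IsSymbol l m n g ↔ Smooth₂ g ∧ ∀ k, SymBound l k m n g := by
  constructor
  · refine fun h => ⟨h.1, fun k => ?_⟩
    have hb : ∀ {m n : ℝ} {g : ℝ → ℝ → ℝ}, IsSymbol l m n g →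
        ∃ C, ∀ x ξ, |g x ξ| ≤ C * wt l m n x ξ := by
      intro m n g h
      obtain ⟨C, hC⟩ := (isSymbol_iff_iterate.1 h).2 0 0
      exact ⟨C, fun x ξ => by simpa using hC x ξ⟩
    induction k generalizing m n g with
    | zero => exact hb h
    | succ k ih => exact ⟨hb h, ih h.dX, ih h.dXi⟩
  · rintro ⟨h1, h2⟩
    refine isSymbol_iff_iterate.2 ⟨h1, fun k₁ k₂ => ?_⟩
    have e1 : ∀ (j k : ℕ) {m n : ℝ} {g : ℝ → ℝ → ℝ}, SymBound l (k + j) m n g →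
        SymBound l k m (n - j) (_root_.dX^[j] g) := by
      intro j
      induction j with
      | zero => intro k m n g h; simpa using h
      | succ j ih =>
        intro k m n g h
        rw [Function.iterate_succ_apply]
        convert ih k (m := m) (n := n - 1) h.2.1 using 1
        push_cast; ring
    have e2 : ∀ (j k : ℕ) {m n : ℝ} {g : ℝ → ℝ → ℝ}, SymBound l (k + j) m n g →
        SymBound l k (m - j * l) n (_root_.dXi^[j] g) := by
      intro j
      induction j with
      | zero => intro k m n g h; simpa using h
      | succ j ih =>
        intro k m n g h
        rw [Function.iterate_succ_apply]
        convert ih k (m := m - l) (n := n) h.2.2 using 1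
        push_cast; ring
    exact e2 k₁ 0 (e1 k₂ (0 + k₁) (h2 _))

lemma IsSymbol.sym {l m n : ℝ} {g : ℝ → ℝ → ℝ} (h : IsSymbol l m n g) (k : ℕ) :
    SymBound l k m n g := (isSymbol_iff.1 h).2 k

lemma IsSymbol.mono {l : ℝ} (hl : 1 ≤ l) {m n m' n' : ℝ} {g : ℝ → ℝ → ℝ}
    (h : IsSymbol l m n g) (h1 : m ≤ m') (h2 : m + n ≤ m' + n') : IsSymbol l m' n' g :=
  isSymbol_iff.2 ⟨h.1, fun k => (h.sym k).mono hl h1 h2⟩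

lemma IsSymbol.add {l : ℝ} {m n : ℝ} {g h : ℝ → ℝ → ℝ} (hg : IsSymbol l m n g)
    (hh : IsSymbol l m n h) : IsSymbol l m n (fun x ξ => g x ξ + h x ξ) :=
  isSymbol_iff.2 ⟨hg.smooth.add hh.smooth, fun k => (hg.sym k).add (hh.sym k) hg.1 hh.1⟩

lemma IsSymbol.mul {l : ℝ} (hl : 1 ≤ l) {m n m' n' : ℝ} {g h : ℝ → ℝ → ℝ}
    (hg : IsSymbol l m n g) (hh : IsSymbol l m' n' h) :
    IsSymbol l (m + m') (n + n') (fun x ξ => g x ξ * h x ξ) :=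
  isSymbol_iff.2 ⟨hg.smooth.mul hh.smooth, fun k => (hg.sym k).mul hl (hh.sym k) hg.1 hh.1⟩

lemma isSymbol_const {l : ℝ} (c : ℝ) : IsSymbol l 0 0 (fun _ _ => c) :=
  isSymbol_iff.2 ⟨smooth₂_const c, fun k => sym_const k c⟩

lemma IsSymbol.inv {l : ℝ} (hl : 1 ≤ l) {m n c : ℝ} {g : ℝ → ℝ → ℝ} (hg : IsSymbol l m n g)
    (hc : 0 < c) (hlow : ∀ x ξ, c * wt l m n x ξ ≤ g x ξ) :
    IsSymbol l (-m) (-n) (fun x ξ => (g x ξ)⁻¹) :=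
  isSymbol_iff.2 ⟨hg.smooth.inv fun x ξ =>
    (lt_of_lt_of_le (mul_pos hc (wt_pos hl _ _ _ _)) (hlow x ξ)).ne',
    fun k => (hg.sym k).inv hl hg.1 hc hlow⟩

lemma isSymbol_fst {l : ℝ} : IsSymbol l 0 1 (fun x _ => x) := by
  refine isSymbol_iff.2 ⟨contDiff_fst, fun k => ?_⟩
  have hb : ∃ C, ∀ x ξ : ℝ, |x| ≤ C * wt l 0 1 x ξ :=
    ⟨1, fun x ξ => by simpa [wt] using abs_le_jap x⟩
  cases k with
  | zero => exact hb
  | succ k =>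
    refine ⟨hb, ?_, ?_⟩
    · have : dX (fun x _ => x) = fun _ _ => 1 := by funext x ξ; simp [dX]
      rw [this, sub_self]; exact sym_const k 1
    · have : dXi (fun x _ => x) = fun _ _ => 0 := by funext x ξ; simp [dXi]
      rw [this]; exact sym_zero _ _ _

lemma isSymbol_snd {l : ℝ} (hl : 1 ≤ l) : IsSymbol l l 0 (fun _ ξ => ξ) := by
  refine isSymbol_iff.2 ⟨contDiff_snd, fun k => ?_⟩
  have hb : ∃ C, ∀ x ξ : ℝ, |ξ| ≤ C * wt l l 0 x ξ :=
    ⟨1, fun x ξ => by simpa [wt] using abs_le_lam_rpow hl x ξ⟩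
  cases k with
  | zero => exact hb
  | succ k =>
    refine ⟨hb, ?_, ?_⟩
    · have : dX (fun _ ξ => ξ) = fun _ _ => 0 := by funext x ξ; simp [dX]
      rw [this]; exact sym_zero _ _ _
    · have : dXi (fun _ ξ => ξ) = fun _ _ => 1 := by funext x ξ; simp [dXi]
      rw [this, sub_self]; exact sym_const k 1

lemma isSymbol_potential {l : ℝ} {V : ℝ → ℝ} (hV : GoodPotential l V) :
    IsSymbol l 0 (2 * l) (fun x _ => V x) := by
  refine ⟨hV.smooth.comp contDiff_fst, fun k₁ k₂ => ?_⟩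
  cases k₁ with
  | zero =>
    obtain ⟨C, hC⟩ := hV.growth k₂
    exact ⟨C, fun x ξ => by simpa using hC x⟩
  | succ k₁ =>
    refine ⟨0, fun x ξ => ?_⟩
    rw [iteratedDeriv_succ']
    simp

/-- Symbol estimates for a sequence of functions whose gradients are expressed, up to symbols,
through the next function of the sequence. -/
lemma isSymbol_of_rec {l : ℝ} (hl : 1 ≤ l) {V : ℝ → ℝ} (hV : GoodPotential l V) {n : ℝ}
    {u α β : ℕ → ℝ → ℝ → ℝ}
    (hα : ∀ k : ℕ, IsSymbol l (n - 1 - 2 * l * k) 0 (α k))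
    (hβ : ∀ k : ℕ, IsSymbol l (n - l - 2 * l * k) 0 (β k))
    (hb : ∀ k : ℕ, ∃ C, ∀ x ξ, |u k x ξ| ≤ C * wt l (n - 2 * l * k) 0 x ξ)
    (hu : ∀ k x ξ, HasFDerivAt (fun q : ℝ × ℝ => u k q.1 q.2)
      (pairCLM (α k x ξ + deriv V x * u (k + 1) x ξ) (β k x ξ + 2 * ξ * u (k + 1) x ξ)) (x, ξ)) :
    IsSymbol l n 0 (u 0) ∧ IsSymbol l (n - 1) 0 (dX (u 0)) := by
  have hV' : IsSymbol l 0 (2 * l - 1) (fun x _ => deriv V x) := (isSymbol_potential hV).dX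
  have hξ : IsSymbol l l 0 (fun _ ξ => 2 * ξ) := by
    simpa using (isSymbol_const 2).mul hl (isSymbol_snd hl)
  have su := smooth₂_of_hasFDerivAt_rec hV'.smooth hξ.smooth (fun k => (hα k).smooth)
    (fun k => (hβ k).smooth) hu
  have hx : ∀ k, dX (u k) = fun x ξ => α k x ξ + deriv V x * u (k + 1) x ξ := fun k => by
    funext x ξ; exact (hu k x ξ).hasDerivAt_fst.deriv
  have hxi : ∀ k, dXi (u k) = fun x ξ => β k x ξ + 2 * ξ * u (k + 1) x ξ := fun k => by
    funext x ξ; exact (hu k x ξ).hasDerivAt_snd.deriv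
  have main : ∀ N k : ℕ, SymBound l N (n - 2 * l * k) 0 (u k) := by
    intro N
    induction N with
    | zero => exact hb
    | succ N ih =>
      refine fun k => ⟨hb k, ?_, ?_⟩
      · rw [hx]
        refine SymBound.add ?_ ?_ (hα k).smooth (hV'.smooth.mul (su _))
        · exact ((hα k).sym N).mono hl (by linarith) (by linarith)
        · refine ((hV'.sym N).mul hl (ih (k + 1)) hV'.smooth (su _)).mono hl ?_ ?_ <;>
            push_cast <;> linarith
      · rw [hxi]
        refine SymBound.add ?_ ?_ (hβ k).smooth (hξ.smooth.mul (su _))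
        · exact ((hβ k).sym N).mono hl (by linarith) (by linarith)
        · refine ((hξ.sym N).mul hl (ih (k + 1)) hξ.smooth (su _)).mono hl ?_ ?_ <;>
            push_cast <;> linarith
  have hsym : ∀ k : ℕ, IsSymbol l (n - 2 * l * k) 0 (u k) := fun k =>
    isSymbol_iff.2 ⟨su k, fun N => main N k⟩
  refine ⟨by simpa using hsym 0, ?_⟩
  rw [hx]
  refine IsSymbol.add (by simpa using hα 0) ?_
  refine (hV'.mul hl (hsym 1)).mono hl ?_ ?_ <;> push_cast <;> linarith

/-! ### The potential and the Hamiltonian -/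

section Potential

variable {l : ℝ} {V : ℝ → ℝ}

/-- The Hamiltonian `h₀(x,ξ) = ξ² + V(x)`. -/
def ham (V : ℝ → ℝ) (x ξ : ℝ) : ℝ := ξ ^ 2 + V x

/-- The derivative `x V'(x) + 2ξ²` of the Hamiltonian along the Euler vector field. -/
def vir (V : ℝ → ℝ) (x ξ : ℝ) : ℝ := x * deriv V x + 2 * ξ ^ 2

lemma GoodPotential.differentiable (hV : GoodPotential l V) : Differentiable ℝ V :=
  hV.smooth.differentiable (by simp)

lemma GoodPotential.smooth_deriv (hV : GoodPotential l V) : ContDiff ℝ (⊤ : ℕ∞) (deriv V) :=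
  (contDiff_infty_iff_deriv.1 hV.smooth).2

lemma GoodPotential.deriv_neg (hV : GoodPotential l V) (x : ℝ) : deriv V (-x) = -deriv V x := by
  have h : (fun y => V (-y)) = V := funext hV.even
  have := deriv_comp_neg V x
  rw [h] at this
  linarith

lemma GoodPotential.asymptotics (hl : 1 ≤ l) (hV : GoodPotential l V) :
    ∃ R, 1 ≤ R ∧ ∀ x, R ≤ |x| → |x| ^ (2 * l) / 2 ≤ V x ∧ |x| ^ (2 * l) ≤ x * deriv V x := by
  obtain ⟨Vh, -, hexp⟩ := hV.expansion
  obtain ⟨C₀, R₀, h₀⟩ := hexp 0 0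
  obtain ⟨C₁, R₁, h₁⟩ := hexp 0 1
  simp only [Finset.Icc_eq_empty (by norm_num : ¬ 1 ≤ 0), Finset.sum_empty, sub_zero,
    iteratedDeriv_zero, iteratedDeriv_one, Nat.cast_zero, zero_add, mul_one, Nat.cast_one] at h₀ h₁
  have a0 := abs_nonneg R₀
  have a1 := abs_nonneg R₁
  have a2 := abs_nonneg C₀
  have a3 := abs_nonneg C₁
  have key : ∀ x, 1 + |R₀| + |R₁| + 2 * |C₀| + |C₁| ≤ x →
      x ^ (2 * l) / 2 ≤ V x ∧ x ^ (2 * l) ≤ x * deriv V x := by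
    intro x hx
    have hx1 : 1 ≤ x := by linarith
    have hx0 : 0 < x := by linarith
    have hax : |x| = x := abs_of_pos hx0
    have g₀ := h₀ x (by rw [hax]; linarith [le_abs_self R₀])
    have g₁ := h₁ x (by rw [hax]; linarith [le_abs_self R₁])
    have hd : HasDerivAt (fun y : ℝ => V y - |y| ^ (2 * l))
        (deriv V x - 2 * l * x ^ (2 * l - 1)) x := by
      refine (hV.differentiable x).hasDerivAt.sub ?_
      refine (Real.hasDerivAt_rpow_const (p := 2 * l) (Or.inl hx0.ne')).congr_of_eventuallyEq ?_
      filter_upwards [lt_mem_nhds hx0] with y hy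
      rw [abs_of_pos hy]
    rw [hd.deriv, hax] at g₁
    rw [hax] at g₀
    have hP : 0 < x ^ (2 * l - 2) := Real.rpow_pos_of_pos hx0 _
    have e0 : x ^ (2 * l) = x ^ (2 * l - 2) * x ^ 2 := by
      rw [← Real.rpow_natCast, ← Real.rpow_add hx0]; congr 1; push_cast; ring
    have e1 : x ^ (2 * l - 1) * x = x ^ (2 * l) := by
      rw [← Real.rpow_add_one hx0.ne']; congr 1; ring
    have e2 : x ^ (2 * l - 2 - 1) * x = x ^ (2 * l - 2) := by
      rw [← Real.rpow_add_one hx0.ne']; congr 1; ring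
    have hxx : x ≤ x ^ 2 := by nlinarith
    constructor
    · have b1 : C₀ * x ^ (2 * l - 2) ≤ x ^ 2 / 2 * x ^ (2 * l - 2) :=
        mul_le_mul_of_nonneg_right (by linarith [le_abs_self C₀]) hP.le
      have := (abs_le.1 g₀).1
      nlinarith
    · have b1 : C₁ * x ^ (2 * l - 2) ≤ x ^ 2 * x ^ (2 * l - 2) :=
        mul_le_mul_of_nonneg_right (by linarith [le_abs_self C₁]) hP.le
      have b2 := mul_le_mul_of_nonneg_right (abs_le.1 g₁).1 hx0.le
      have b3 : x ^ (2 * l) ≤ l * x ^ (2 * l) := le_mul_of_one_le_left (by positivity) hl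
      have b4 : (deriv V x - 2 * l * x ^ (2 * l - 1)) * x
          = x * deriv V x - 2 * l * x ^ (2 * l) := by rw [← e1]; ring
      have b5 : -(C₁ * x ^ (2 * l - 2 - 1)) * x = -(C₁ * x ^ (2 * l - 2)) := by rw [← e2]; ring
      rw [b4, b5] at b2
      nlinarith
  refine ⟨1 + |R₀| + |R₁| + 2 * |C₀| + |C₁|, by linarith, fun x hx => ?_⟩
  rcases abs_cases x with ⟨h, -⟩ | ⟨h, -⟩
  · rw [h] at hx ⊢; exact key x hx
  · rw [h] at hx ⊢
    have := key (-x) hx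
    rwa [hV.even, hV.deriv_neg, neg_mul_neg] at this

lemma GoodPotential.deriv_pos (hl : 1 ≤ l) (hV : GoodPotential l V) {x : ℝ} (hx : 0 < x) :
    0 < deriv V x := by
  obtain ⟨R, hR1, hR⟩ := hV.asymptotics hl
  have hR0 : 0 < R := by linarith
  have hRpos : 0 < deriv V R := by
    have := (hR R (le_abs_self R)).2
    have h2 : 0 < |R| ^ (2 * l) := Real.rpow_pos_of_pos (abs_pos.2 hR0.ne') _
    exact pos_of_mul_pos_right (h2.trans_le this) hR0.le
  by_contra hneg
  push Not at hneg
  have hiv := intermediate_value_uIcc (f := deriv V) (a := x) (b := R)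
    hV.smooth_deriv.continuous.continuousOn
  obtain ⟨y, hy, hy0⟩ := hiv (Set.mem_uIcc.2 (Or.inl ⟨hneg, hRpos.le⟩))
  refine hV.deriv_ne y ?_ hy0
  rcases Set.mem_uIcc.1 hy with h | h
  · exact (lt_of_lt_of_le hx h.1).ne'
  · exact (lt_of_lt_of_le hR0 h.1).ne'

lemma GoodPotential.mul_deriv_pos (hl : 1 ≤ l) (hV : GoodPotential l V) {x : ℝ} (hx : x ≠ 0) :
    0 < x * deriv V x := by
  rcases lt_or_gt_of_ne hx with h | h
  · have := hV.deriv_pos hl (neg_pos.2 h)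
    rw [hV.deriv_neg] at this
    exact mul_pos_of_neg_of_neg h (by linarith)
  · exact mul_pos h (hV.deriv_pos hl h)

lemma GoodPotential.mul_deriv_nonneg (hl : 1 ≤ l) (hV : GoodPotential l V) (x : ℝ) :
    0 ≤ x * deriv V x := by
  by_cases hx : x = 0
  · simp [hx]
  · exact (hV.mul_deriv_pos hl hx).le

lemma GoodPotential.strictMonoOn (hl : 1 ≤ l) (hV : GoodPotential l V) :
    StrictMonoOn V (Set.Ici 0) := by
  refine strictMonoOn_of_deriv_pos (convex_Ici 0) hV.smooth.continuous.continuousOn fun x hx => ?_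
  rw [interior_Ici] at hx
  exact hV.deriv_pos hl hx

lemma GoodPotential.apply_abs (hV : GoodPotential l V) (x : ℝ) : V |x| = V x := by
  rcases abs_choice x with h | h <;> rw [h]
  exact hV.even x

lemma GoodPotential.min_lt (hl : 1 ≤ l) (hV : GoodPotential l V) {x : ℝ} (hx : x ≠ 0) :
    V 0 < V x := by
  rw [← hV.apply_abs x]
  exact hV.strictMonoOn hl Set.self_mem_Ici (abs_nonneg x) (abs_pos.2 hx)

lemma GoodPotential.min_le (hl : 1 ≤ l) (hV : GoodPotential l V) (x : ℝ) : V 0 ≤ V x := by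
  by_cases hx : x = 0
  · rw [hx]
  · exact (hV.min_lt hl hx).le

lemma min_le_ham (hl : 1 ≤ l) (hV : GoodPotential l V) (x ξ : ℝ) : V 0 ≤ ham V x ξ := by
  unfold ham; nlinarith [hV.min_le hl x, sq_nonneg ξ]

lemma smooth₂_ham (hV : GoodPotential l V) : Smooth₂ (ham V) := by
  have := hV.smooth
  unfold Smooth₂ ham
  fun_prop

lemma hasFDerivAt_ham (hV : GoodPotential l V) (x ξ : ℝ) :
    HasFDerivAt (fun q : ℝ × ℝ => ham V q.1 q.2) (pairCLM (deriv V x) (2 * ξ)) (x, ξ) := by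
  convert (smooth₂_ham hV).hasFDerivAt x ξ using 2
  · exact (((hV.differentiable x).hasDerivAt.const_add (ξ ^ 2)).deriv).symm
  · simp [dXi, ham]

lemma continuous_ham (hV : GoodPotential l V) : Continuous fun q : ℝ × ℝ => ham V q.1 q.2 :=
  (smooth₂_ham hV).continuous

lemma continuous_vir (hV : GoodPotential l V) : Continuous fun q : ℝ × ℝ => vir V q.1 q.2 := by
  have := hV.smooth_deriv.continuous
  unfold vir
  fun_prop

lemma vir_pos (hl : 1 ≤ l) (hV : GoodPotential l V) {x ξ : ℝ} (h : V 0 < ham V x ξ) :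
    0 < vir V x ξ := by
  unfold vir
  by_cases hx : x = 0
  · subst hx
    have : ξ ≠ 0 := by rintro rfl; simp [ham] at h
    rw [zero_mul, zero_add]
    positivity
  · have := hV.mul_deriv_pos hl hx
    nlinarith [sq_nonneg ξ]

lemma ham_le_lam (hl : 1 ≤ l) (hV : GoodPotential l V) :
    ∃ C, 0 < C ∧ ∀ x ξ, 1 + (ham V x ξ - V 0) ≤ C * lam l x ξ ^ (2 * l) := by
  obtain ⟨C, hC⟩ := hV.growth 0
  refine ⟨2 + |V 0| + |C| * 2 ^ (2 * l), by positivity, fun x ξ => ?_⟩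
  have hL := lam_pos hl x ξ
  have h1 : V x ≤ |C| * 2 ^ (2 * l) * lam l x ξ ^ (2 * l) := by
    have := hC x
    simp only [iteratedDeriv_zero, Nat.cast_zero, sub_zero] at this
    calc V x ≤ C * jap x ^ (2 * l) := (le_abs_self _).trans this
      _ ≤ |C| * (2 * lam l x ξ) ^ (2 * l) := by
          refine mul_le_mul (le_abs_self C) ?_ (Real.rpow_nonneg (jap_pos x).le _) (abs_nonneg C)
          exact Real.rpow_le_rpow (jap_pos x).le (jap_le_lam hl x ξ) (by linarith)
      _ = _ := by rw [Real.mul_rpow zero_le_two hL.le]; ring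
  have h2 := sq_le_lam_rpow hl x ξ
  have h3 : 1 ≤ lam l x ξ ^ (2 * l) := Real.one_le_rpow (one_le_lam hl x ξ) (by linarith)
  have h4 : |V 0| ≤ |V 0| * lam l x ξ ^ (2 * l) := le_mul_of_one_le_right (abs_nonneg _) h3
  unfold ham
  nlinarith [neg_abs_le (V 0)]

lemma lam_le_ham (hl : 1 ≤ l) (hV : GoodPotential l V) :
    ∃ C, 0 < C ∧ ∀ x ξ, lam l x ξ ^ (2 * l) ≤ C * (1 + (ham V x ξ - V 0)) := by
  obtain ⟨R, hR1, hR⟩ := hV.asymptotics hl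
  refine ⟨2 + 2 * |V 0| + R ^ (2 * l), by positivity, fun x ξ => ?_⟩
  have hmin := hV.min_le hl x
  have hR0 : 0 ≤ R ^ (2 * l) := by positivity
  have hx : |x| ^ (2 * l) ≤ 2 * (V x - V 0) + 2 * |V 0| + R ^ (2 * l) := by
    rcases le_total R |x| with h | h
    · have := (hR x h).1
      linarith [le_abs_self (V 0), neg_abs_le (V 0)]
    · have := Real.rpow_le_rpow (abs_nonneg x) h (by linarith : 0 ≤ 2 * l)
      linarith [abs_nonneg (V 0)]
  rw [lam_rpow_two_mul hl]
  unfold ham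
  have := mul_nonneg (abs_nonneg (V 0)) (by nlinarith [sq_nonneg ξ] : 0 ≤ ξ ^ 2 + V x - V 0)
  have := mul_nonneg hR0 (by nlinarith [sq_nonneg ξ] : 0 ≤ ξ ^ 2 + V x - V 0)
  nlinarith [sq_nonneg ξ, abs_nonneg (V 0)]

lemma lam_le_vir (hl : 1 ≤ l) (hV : GoodPotential l V) {E : ℝ} (hE : V 0 < E) :
    ∃ c, 0 < c ∧ ∀ x ξ, E ≤ ham V x ξ → c * lam l x ξ ^ (2 * l) ≤ vir V x ξ := by
  obtain ⟨R, hR1, hR⟩ := hV.asymptotics hl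
  have hR0 : 0 ≤ R ^ (2 * l) := by positivity
  set S := 1 + R ^ (2 * l) with hS
  have hcont : Continuous fun q : ℝ × ℝ => vir V q.1 q.2 / lam l q.1 q.2 ^ (2 * l) :=
    (continuous_vir hV).div ((continuous_lam hl).rpow_const fun q => Or.inl (lam_pos hl _ _).ne')
      fun q => (Real.rpow_pos_of_pos (lam_pos hl _ _) _).ne'
  have hK : IsCompact ((Set.Icc (-R) R ×ˢ Set.Icc (-S) S) ∩ {q : ℝ × ℝ | E ≤ ham V q.1 q.2}) :=
    (isCompact_Icc.prod isCompact_Icc).inter_right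
      (isClosed_le continuous_const (continuous_ham hV))
  obtain ⟨c, hc, hcK⟩ := hK.exists_forall_le' (a := 0) hcont.continuousOn fun q hq =>
    div_pos (vir_pos hl hV (hE.trans_le hq.2)) (Real.rpow_pos_of_pos (lam_pos hl _ _) _)
  refine ⟨min c (1 / 2), by positivity, fun x ξ h => ?_⟩
  have hlam : 0 < lam l x ξ ^ (2 * l) := Real.rpow_pos_of_pos (lam_pos hl _ _) _
  by_cases hin : |x| ≤ R ∧ |ξ| ≤ S
  · have := hcK (x, ξ) ⟨⟨abs_le.1 hin.1, abs_le.1 hin.2⟩, h⟩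
    rw [le_div_iff₀ hlam] at this
    exact (mul_le_mul_of_nonneg_right (min_le_left _ _) hlam.le).trans this
  · refine (mul_le_mul_of_nonneg_right (min_le_right _ _) hlam.le).trans ?_
    rw [lam_rpow_two_mul hl]
    unfold vir
    have h0 := hV.mul_deriv_nonneg hl x
    rcases le_total R |x| with hx | hx
    · have h1 := (hR x hx).2
      have h2 : 1 ≤ |x| ^ (2 * l) := Real.one_le_rpow (hR1.trans hx) (by linarith)
      nlinarith [sq_nonneg ξ]
    · have hξ : S < |ξ| := by
        by_contra hcon
        exact hin ⟨hx, not_lt.1 hcon⟩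
      have h1 := Real.rpow_le_rpow (abs_nonneg x) hx (by linarith : 0 ≤ 2 * l)
      have h2 : S ≤ ξ ^ 2 := by
        rw [← sq_abs]; nlinarith
      nlinarith

/-- A smooth function of the energy, equal to `0` below `a` and to `1` above `b`. -/
def energyCutoff (a b E : ℝ) : ℝ := Real.smoothTransition ((E - a) / (b - a))

lemma energyCutoff_of_le {a b E : ℝ} (hab : a < b) (h : E ≤ a) : energyCutoff a b E = 0 :=
  Real.smoothTransition.zero_of_nonpos
    (div_nonpos_of_nonpos_of_nonneg (by linarith) (by linarith))

lemma energyCutoff_of_ge {a b E : ℝ} (hab : a < b) (h : b ≤ E) : energyCutoff a b E = 1 :=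
  Real.smoothTransition.one_of_one_le ((one_le_div (by linarith)).2 (by linarith))

lemma smooth₂_energyCutoff (hV : GoodPotential l V) (a b : ℝ) :
    Smooth₂ fun x ξ => energyCutoff a b (ham V x ξ) := by
  unfold energyCutoff
  exact Real.smoothTransition.contDiff.comp
    ((ContDiff.sub (smooth₂_ham hV) contDiff_const).div_const (b - a))

lemma isSymbol_one_sub_energyCutoff (hl : 1 ≤ l) (hV : GoodPotential l V) {a b : ℝ}
    (hab : a < b) (m n : ℝ) : IsSymbol l m n fun x ξ => 1 - energyCutoff a b (ham V x ξ) := by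
  have hs : Smooth₂ fun x ξ => 1 - energyCutoff a b (ham V x ξ) :=
    ContDiff.sub contDiff_const (smooth₂_energyCutoff hV a b)
  obtain ⟨C, hC, h⟩ := lam_le_ham hl hV
  refine isSymbol_iff.2 ⟨hs, fun k => sym_of_compact_support hl k m n
    (max 1 (C * (1 + (b - V 0)))) hs fun x ξ hR => ?_⟩
  rw [energyCutoff_of_ge hab, sub_self]
  have h1 : max 1 (C * (1 + (b - V 0))) ≤ lam l x ξ ^ (2 * l) := by
    rcases hR with hR | hR
    · have h1 := one_le_lam hl x ξ
      calc _ ≤ |x| := hR.le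
        _ ≤ lam l x ξ := abs_le_lam hl x ξ
        _ = lam l x ξ ^ (1 : ℝ) := (Real.rpow_one _).symm
        _ ≤ _ := Real.rpow_le_rpow_of_exponent_le h1 (by linarith)
    · have h1 : 1 < |ξ| := (le_max_left _ _).trans_lt hR
      have h2 := sq_le_lam_rpow hl x ξ
      rw [← sq_abs] at h2
      nlinarith
  have h2 := ((le_max_right _ _).trans h1).trans (h x ξ)
  have := le_of_mul_le_mul_left h2 hC
  linarith

lemma isSymbol_deriv_potential (hV : GoodPotential l V) :
    IsSymbol l 0 (2 * l - 1) (fun x _ => deriv V x) := (isSymbol_potential hV).dX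

lemma isSymbol_vir (hl : 1 ≤ l) (hV : GoodPotential l V) : IsSymbol l (2 * l) 0 (vir V) := by
  have h1 := (isSymbol_fst.mul hl (isSymbol_deriv_potential hV)).mono hl (m' := 2 * l) (n' := 0)
    (by linarith) (by linarith)
  have h2 := (((isSymbol_const 2).mul hl (isSymbol_snd hl)).mul hl (isSymbol_snd hl)).mono hl
    (m' := 2 * l) (n' := 0) (by linarith) (by linarith)
  convert h1.add h2 using 3
  unfold vir; ring

/-- A modification of `vir` near the equilibrium which is bounded below by `λ^{2l}`. -/
def virMod (V : ℝ → ℝ) (a b x ξ : ℝ) : ℝ := vir V x ξ + (1 - energyCutoff a b (ham V x ξ))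

lemma virMod_eq {a b x ξ : ℝ} (hab : a < b) (h : b ≤ ham V x ξ) : virMod V a b x ξ = vir V x ξ := by
  rw [virMod, energyCutoff_of_ge hab h]; ring

lemma isSymbol_virMod (hl : 1 ≤ l) (hV : GoodPotential l V) {a b : ℝ} (hab : a < b) :
    IsSymbol l (2 * l) 0 (virMod V a b) :=
  (isSymbol_vir hl hV).add (isSymbol_one_sub_energyCutoff hl hV hab _ _)

lemma exists_lower_bound_of_energyCutoff (hl : 1 ≤ l) (hV : GoodPotential l V) {a b m : ℝ}
    (hab : a < b) {g : ℝ → ℝ → ℝ} (h0 : ∀ x ξ, 0 ≤ g x ξ) {c : ℝ} (hc : 0 < c)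
    (hg : ∀ x ξ, a ≤ ham V x ξ → c * wt l m 0 x ξ ≤ g x ξ) :
    ∃ c, 0 < c ∧ ∀ x ξ, c * wt l m 0 x ξ ≤ g x ξ + (1 - energyCutoff a b (ham V x ξ)) := by
  obtain ⟨C, hC, h⟩ := lam_le_ham hl hV
  obtain ⟨K, hK0, hK⟩ := wt_mono hl (le_max_left m 0) (m := m) (n := 0) (n' := 0)
    (by linarith [le_max_left m 0])
  set D := max 1 (C * (1 + (a - V 0))) with hD
  have hD1 : 1 ≤ D := le_max_left _ _
  set B := K * D ^ (max m 0 / (2 * l)) with hB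
  have hB0 : 0 < B := by positivity
  refine ⟨min c B⁻¹, by positivity, fun x ξ => ?_⟩
  have hw := wt_pos hl m 0 x ξ
  rcases le_total a (ham V x ξ) with hle | hle
  · have h1 : energyCutoff a b (ham V x ξ) ≤ 1 := Real.smoothTransition.le_one _
    have h2 := (mul_le_mul_of_nonneg_right (min_le_left c B⁻¹) hw.le).trans (hg x ξ hle)
    linarith
  · rw [energyCutoff_of_le hab hle]
    have hl1 : lam l x ξ ^ (2 * l) ≤ D :=
      (h x ξ).trans ((mul_le_mul_of_nonneg_left (by linarith) hC.le).trans (le_max_right _ _))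
    have hlam : wt l m 0 x ξ ≤ B := by
      refine (hK x ξ).trans (mul_le_mul_of_nonneg_left ?_ hK0.le)
      unfold wt
      rw [Real.rpow_zero, mul_one]
      have e : lam l x ξ ^ (max m 0) = (lam l x ξ ^ (2 * l)) ^ (max m 0 / (2 * l)) := by
        rw [← Real.rpow_mul (lam_pos hl x ξ).le]; congr 1; field_simp
      rw [e]
      exact Real.rpow_le_rpow (Real.rpow_nonneg (lam_pos hl x ξ).le _) hl1
        (div_nonneg (le_max_right _ _) (by linarith))
    have : min c B⁻¹ * wt l m 0 x ξ ≤ B⁻¹ * B :=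
      mul_le_mul (min_le_right _ _) hlam hw.le (by positivity)
    rw [inv_mul_cancel₀ hB0.ne'] at this
    linarith [h0 x ξ]

lemma vir_nonneg (hl : 1 ≤ l) (hV : GoodPotential l V) (x ξ : ℝ) : 0 ≤ vir V x ξ := by
  unfold vir; nlinarith [hV.mul_deriv_nonneg hl x, sq_nonneg ξ]

lemma exists_lower_bound_virMod (hl : 1 ≤ l) (hV : GoodPotential l V) {a b : ℝ} (ha : V 0 < a)
    (hab : a < b) : ∃ c, 0 < c ∧ ∀ x ξ, c * wt l (2 * l) 0 x ξ ≤ virMod V a b x ξ := by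
  obtain ⟨c, hc, h⟩ := lam_le_vir hl hV ha
  exact exists_lower_bound_of_energyCutoff hl hV hab (vir_nonneg hl hV) hc fun x ξ hx => by
    simpa [wt] using h x ξ hx

lemma isSymbol_virMod_inv (hl : 1 ≤ l) (hV : GoodPotential l V) {a b : ℝ} (ha : V 0 < a)
    (hab : a < b) : IsSymbol l (-(2 * l)) 0 (fun x ξ => (virMod V a b x ξ)⁻¹) := by
  obtain ⟨c, hc, h⟩ := exists_lower_bound_virMod hl hV ha hab
  simpa using (isSymbol_virMod hl hV hab).inv hl hc h

/-- On an energy level, the natural rescaling of phase space makes the level curve comparable to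
the unit circle. -/
lemma rescaled_level_bounds (hl : 1 ≤ l) (hV : GoodPotential l V) {E₁ : ℝ} (hE₁ : V 0 < E₁) :
    ∃ c C, 0 < c ∧ 0 < C ∧ ∀ x ξ, E₁ ≤ ham V x ξ →
      c ≤ x ^ 2 / ((1 + (ham V x ξ - V 0)) ^ (1 / (2 * l))) ^ 2
          + ξ ^ 2 / ((1 + (ham V x ξ - V 0)) ^ (1 / 2 : ℝ)) ^ 2 ∧
      x ^ 2 / ((1 + (ham V x ξ - V 0)) ^ (1 / (2 * l))) ^ 2
          + ξ ^ 2 / ((1 + (ham V x ξ - V 0)) ^ (1 / 2 : ℝ)) ^ 2 ≤ C := by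
  obtain ⟨A, hA, hlow⟩ := lam_le_ham hl hV
  obtain ⟨G, hG⟩ := hV.growth 0
  simp only [iteratedDeriv_zero, Nat.cast_zero, sub_zero] at hG
  set δ := E₁ - V 0 with hδ
  have hδ0 : 0 < δ := by linarith
  obtain ⟨η, hη, hηV⟩ : ∃ η, 0 < η ∧ ∀ x, |x| < η → V x < V 0 + δ / 2 := by
    have := (hV.smooth.continuous.tendsto 0).eventually_lt_const
      (by linarith : V 0 < V 0 + δ / 2)
    obtain ⟨η, hη, h⟩ := Metric.eventually_nhds_iff.1 this
    exact ⟨η, hη, fun x hx => h (by simpa using hx)⟩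
  set G' := 1 + |G| + |V 0| with hG'
  have hG'0 : 0 < G' := by positivity
  set κ := δ / (2 * (1 + δ)) with hκ
  have hκ0 : 0 < κ := by positivity
  set c₃ := (κ / G') ^ (1 / l) with hc₃
  have hc₃0 : 0 < c₃ := by positivity
  set c₄ := c₃ / (1 + 1 / η ^ 2) with hc₄
  have hc₄0 : 0 < c₄ := by positivity
  refine ⟨min κ c₄, A ^ (1 / l) + 1, by positivity, by positivity, fun x ξ hx => ?_⟩
  set τ := 1 + (ham V x ξ - V 0) with hτ
  have hτδ : 1 + δ ≤ τ := by linarith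
  have hτ0 : 0 < τ := by linarith
  have ea : (τ ^ (1 / (2 * l))) ^ 2 = τ ^ (1 / l) := by
    rw [← Real.rpow_mul_natCast hτ0.le]; congr 1; push_cast; field_simp
  have eb : (τ ^ (1 / 2 : ℝ)) ^ 2 = τ := by
    rw [← Real.rpow_mul_natCast hτ0.le]; norm_num
  rw [ea, eb]
  have hτa : 0 < τ ^ (1 / l) := by positivity
  have hmin := hV.min_le hl x
  have hτe : τ = 1 + (ξ ^ 2 + V x - V 0) := rfl
  have n1 : 0 ≤ x ^ 2 / τ ^ (1 / l) := by positivity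
  have n2 : 0 ≤ ξ ^ 2 / τ := by positivity
  constructor
  · by_cases hcase : (τ - 1) / 2 ≤ ξ ^ 2
    · have : κ ≤ ξ ^ 2 / τ := by
        rw [hκ, div_le_div_iff₀ (by positivity) hτ0]
        nlinarith
      linarith [min_le_left κ c₄]
    · push Not at hcase
      have hVx : (τ - 1) / 2 ≤ V x - V 0 := by linarith
      have hκτ : κ * τ ≤ (τ - 1) / 2 := by
        rw [hκ, div_mul_eq_mul_div, div_le_div_iff₀ (by positivity) two_pos]
        nlinarith
      have hj1 : 1 ≤ jap x ^ (2 * l) := Real.one_le_rpow (one_le_jap x) (by linarith)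
      have hj : V x - V 0 ≤ G' * jap x ^ (2 * l) := by
        have h1 := (le_abs_self _).trans (hG x)
        have h2 : G * jap x ^ (2 * l) ≤ |G| * jap x ^ (2 * l) :=
          mul_le_mul_of_nonneg_right (le_abs_self G) (by linarith)
        have h3 : |V 0| ≤ |V 0| * jap x ^ (2 * l) := le_mul_of_one_le_right (abs_nonneg _) hj1
        rw [hG']
        nlinarith [neg_abs_le (V 0)]
      have hj2 : κ / G' * τ ≤ jap x ^ (2 * l) := by
        rw [div_mul_eq_mul_div, div_le_iff₀ hG'0]; linarith
      have hj3 : c₃ * τ ^ (1 / l) ≤ 1 + x ^ 2 := by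
        have := Real.rpow_le_rpow (by positivity) hj2 (by positivity : 0 ≤ 1 / l)
        rw [Real.mul_rpow (by positivity) hτ0.le, ← Real.rpow_mul (jap_pos x).le] at this
        have e : 2 * l * (1 / l) = (2 : ℕ) := by push_cast; field_simp
        rw [e, Real.rpow_natCast] at this
        unfold jap at this
        rwa [Real.sq_sqrt (by positivity)] at this
      have hxη : η ≤ |x| := by
        by_contra hcon
        have := hηV x (not_le.1 hcon)
        linarith
      have hx2 : 1 ≤ x ^ 2 / η ^ 2 := by
        rw [one_le_div (by positivity), ← sq_abs x]
        exact pow_le_pow_left₀ hη.le hxη 2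
      have : c₄ ≤ x ^ 2 / τ ^ (1 / l) := by
        rw [hc₄, div_le_div_iff₀ (by positivity) hτa]
        refine hj3.trans ?_
        have : x ^ 2 * (1 + 1 / η ^ 2) = x ^ 2 + x ^ 2 / η ^ 2 := by ring
        linarith
      linarith [min_le_right κ c₄]
  · have h1 : ξ ^ 2 / τ ≤ 1 := by
      rw [div_le_one hτ0]; linarith
    have h2 : x ^ 2 / τ ^ (1 / l) ≤ A ^ (1 / l) := by
      rw [div_le_iff₀ hτa, ← Real.mul_rpow hA.le hτ0.le]
      have h3 := Real.rpow_le_rpow (by positivity [lam_pos hl x ξ])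
        (hlow x ξ) (by positivity : 0 ≤ 1 / l)
      rw [← Real.rpow_mul (lam_pos hl x ξ).le] at h3
      have e : 2 * l * (1 / l) = (2 : ℕ) := by push_cast; field_simp
      rw [e, Real.rpow_natCast] at h3
      refine le_trans ?_ h3
      rw [← sq_abs x]
      exact pow_le_pow_left₀ (abs_nonneg x) (abs_le_lam hl x ξ) 2
    linarith

end Potential

/-! ### Integrals depending on a parameter -/

lemma hasDerivAt_integral_param {G G' : ℝ → ℝ → ℝ} (hG : Continuous (Function.uncurry G))
    (hG' : Continuous (Function.uncurry G')) (h : ∀ E θ, HasDerivAt (fun e => G e θ) (G' E θ) E)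
    (a b E : ℝ) :
    HasDerivAt (fun e => ∫ t in a..b, G e t) (∫ t in a..b, G' E t) E := by
  obtain ⟨C, hC⟩ := (isCompact_Icc.prod isCompact_uIcc).exists_bound_of_continuousOn
    (s := Set.Icc (E - 1) (E + 1) ×ˢ Set.uIcc a b) hG'.continuousOn
  have hs (e : ℝ) : Continuous (G e) := hG.comp (by fun_prop : Continuous fun t => (e, t))
  have hs' (e : ℝ) : Continuous (G' e) := hG'.comp (by fun_prop : Continuous fun t => (e, t))
  refine (hasDerivAt_integral_of_dominated_loc_of_deriv_le (bound := fun _ => C)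
    (Icc_mem_nhds (by linarith) (by linarith) : Set.Icc (E - 1) (E + 1) ∈ nhds E)
    (Filter.Eventually.of_forall fun e => (hs e).aestronglyMeasurable)
    ((hs E).intervalIntegrable a b) (hs' E).aestronglyMeasurable ?_ (by simp) ?_).2
  · exact Filter.Eventually.of_forall fun t ht e he => hC (e, t) ⟨he, Set.uIoc_subset_uIcc ht⟩
  · exact Filter.Eventually.of_forall fun t _ e _ => h e t

lemma hasFDerivAt_primitive {G G' : ℝ → ℝ → ℝ} (hG : Continuous (Function.uncurry G))
    (hG' : Continuous (Function.uncurry G')) (h : ∀ E θ, HasDerivAt (fun e => G e θ) (G' E θ) E)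
    (E θ : ℝ) :
    HasFDerivAt (fun q : ℝ × ℝ => ∫ t in (0 : ℝ)..q.2, G q.1 t)
      (pairCLM (∫ t in (0 : ℝ)..θ, G' E t) (G E θ)) (E, θ) := by
  have hs (e : ℝ) : Continuous (G e) := hG.comp (by fun_prop : Continuous fun t => (e, t))
  have c1 : Continuous fun q : ℝ × ℝ => ContinuousLinearMap.toSpanSingleton ℝ
      (∫ t in (0 : ℝ)..q.2, G' q.1 t) :=
    (ContinuousLinearMap.toSpanSingletonCLE (𝕜 := ℝ) (E := ℝ)).continuous.comp
      (continuous_parametric_primitive_of_continuous hG')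
  have c2 : Continuous fun q : ℝ × ℝ => ContinuousLinearMap.toSpanSingleton ℝ (G q.1 q.2) :=
    (ContinuousLinearMap.toSpanSingletonCLE (𝕜 := ℝ) (E := ℝ)).continuous.comp hG
  have := hasStrictFDerivAt_uncurry_coprod (𝕜 := ℝ) (u := (E, θ))
    (f := fun e θ => ∫ t in (0 : ℝ)..θ, G e t)
    (f₁ := fun e θ => ContinuousLinearMap.toSpanSingleton ℝ (∫ t in (0 : ℝ)..θ, G' e t))
    (f₂ := fun e θ => ContinuousLinearMap.toSpanSingleton ℝ (G e θ))
    (Filter.Eventually.of_forall fun v =>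
      (hasDerivAt_integral_param hG hG' h 0 v.2 v.1).hasFDerivAt)
    (Filter.Eventually.of_forall fun v =>
      (integral_hasDerivAt_right ((hs v.1).intervalIntegrable _ _)
        ((hs v.1).stronglyMeasurableAtFilter _ _) (hs v.1).continuousAt).hasFDerivAt)
    c1.continuousAt c2.continuousAt
  refine this.hasFDerivAt.congr_fderiv ?_
  ext <;> simp [Function.HasUncurry.uncurry]

/-! ### Polar coordinates adapted to the energy levels -/

section Polar

variable {l : ℝ} {V : ℝ → ℝ}

open Classical in
/-- The distance to the origin of the point of energy `E` in the direction `θ`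
(`0` if there is none). -/
def polarRadius (V : ℝ → ℝ) (E θ : ℝ) : ℝ :=
  if h : ∃ r, 0 < r ∧ ham V (r * cos θ) (r * sin θ) = E then h.choose else 0

lemma hasDerivAt_ham_ray (hV : GoodPotential l V) (θ r : ℝ) :
    HasDerivAt (fun r => ham V (r * cos θ) (r * sin θ))
      (deriv V (r * cos θ) * cos θ + 2 * (r * sin θ) * sin θ) r := by
  have := (hasFDerivAt_ham hV (r * cos θ) (r * sin θ)).comp_hasDerivAt r
    ((hasDerivAt_mul_const (cos θ)).prodMk (hasDerivAt_mul_const (sin θ)))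
  simpa [Function.comp_def] using this

lemma lt_ham_of_ne (hl : 1 ≤ l) (hV : GoodPotential l V) {x ξ : ℝ} (h : x ≠ 0 ∨ ξ ≠ 0) :
    V 0 < ham V x ξ := by
  unfold ham
  rcases h with h | h
  · nlinarith [hV.min_lt hl h, sq_nonneg ξ]
  · have := hV.min_le hl x
    have := sq_pos_of_ne_zero h
    linarith

lemma ham_ray_strictMonoOn (hl : 1 ≤ l) (hV : GoodPotential l V) (θ : ℝ) :
    StrictMonoOn (fun r => ham V (r * cos θ) (r * sin θ)) (Set.Ici 0) := by
  refine strictMonoOn_of_deriv_pos (convex_Ici 0)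
    (fun r _ => (hasDerivAt_ham_ray hV θ r).continuousAt.continuousWithinAt) fun r hr => ?_
  rw [interior_Ici] at hr
  have hr : 0 < r := hr
  rw [(hasDerivAt_ham_ray hV θ r).deriv]
  have h := vir_pos hl hV (lt_ham_of_ne hl hV (x := r * cos θ) (ξ := r * sin θ) ?_)
  · unfold vir at h
    refine pos_of_mul_pos_right (a := r) ?_ hr.le
    nlinarith
  · by_contra! hcon
    have h1 : cos θ = 0 := by simpa [hr.ne'] using hcon.1
    have h2 : sin θ = 0 := by simpa [hr.ne'] using hcon.2
    have := Real.sin_sq_add_cos_sq θ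
    simp [h1, h2] at this

lemma exists_ham_ray_eq (hl : 1 ≤ l) (hV : GoodPotential l V) {E : ℝ} (hE : V 0 < E) (θ : ℝ) :
    ∃ r, 0 < r ∧ ham V (r * cos θ) (r * sin θ) = E := by
  obtain ⟨C, hC, h⟩ := lam_le_ham hl hV
  set K := 1 + C * (1 + (E - V 0)) with hK
  have hK1 : 1 < K := by rw [hK]; nlinarith
  have hbig : E < ham V (2 * K * cos θ) (2 * K * sin θ) := by
    by_contra! hcon
    have h1 : lam l (2 * K * cos θ) (2 * K * sin θ) ^ (2 * l) < K :=
      (h _ _).trans_lt (by rw [hK]; nlinarith)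
    have h2 := sq_le_lam_rpow hl (2 * K * cos θ) (2 * K * sin θ)
    have h3 : |2 * K * cos θ| < K := by
      refine lt_of_le_of_lt ?_ h1
      calc _ ≤ lam l (2 * K * cos θ) (2 * K * sin θ) := abs_le_lam hl _ _
        _ = lam l (2 * K * cos θ) (2 * K * sin θ) ^ (1 : ℝ) := (Real.rpow_one _).symm
        _ ≤ _ := Real.rpow_le_rpow_of_exponent_le (one_le_lam hl _ _) (by linarith)
    have h4 := sq_lt_sq' (neg_lt_of_abs_lt h3) (lt_of_abs_lt h3)
    nlinarith [Real.sin_sq_add_cos_sq θ]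
  have hcont : ContinuousOn (fun r => ham V (r * cos θ) (r * sin θ)) (Set.Icc 0 (2 * K)) :=
    fun r _ => (hasDerivAt_ham_ray hV θ r).continuousAt.continuousWithinAt
  obtain ⟨r, hr, hrE⟩ := intermediate_value_Icc (by linarith) hcont
    ⟨by simpa [ham] using hE.le, hbig.le⟩
  refine ⟨r, lt_of_le_of_ne hr.1 ?_, hrE⟩
  rintro rfl
  simp [ham] at hrE
  linarith

lemma polarRadius_spec (hl : 1 ≤ l) (hV : GoodPotential l V) {E : ℝ} (hE : V 0 < E) (θ : ℝ) :
    0 < polarRadius V E θ ∧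
      ham V (polarRadius V E θ * cos θ) (polarRadius V E θ * sin θ) = E := by
  have h := exists_ham_ray_eq hl hV hE θ
  rw [polarRadius, dif_pos h]
  exact h.choose_spec

lemma polarRadius_eq (hl : 1 ≤ l) (hV : GoodPotential l V) {E θ r : ℝ} (hr : 0 < r)
    (h : ham V (r * cos θ) (r * sin θ) = E) : polarRadius V E θ = r := by
  have hE : ∃ r, 0 < r ∧ ham V (r * cos θ) (r * sin θ) = E := ⟨r, hr, h⟩
  rw [polarRadius, dif_pos hE]
  exact (ham_ray_strictMonoOn hl hV θ).injOn hE.choose_spec.1.le hr.le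
    (hE.choose_spec.2.trans h.symm)

lemma polarRadius_of_le (hl : 1 ≤ l) (hV : GoodPotential l V) {E : ℝ} (hE : E ≤ V 0) (θ : ℝ) :
    polarRadius V E θ = 0 := by
  refine dif_neg ?_
  rintro ⟨r, hr, h⟩
  have := ham_ray_strictMonoOn hl hV θ Set.self_mem_Ici hr.le hr
  simp only [h] at this
  simp [ham] at this
  linarith

lemma polarRadius_congr (V : ℝ → ℝ) (E : ℝ) {θ θ' : ℝ}
    (h : ∀ r, ham V (r * cos θ) (r * sin θ) = ham V (r * cos θ') (r * sin θ')) :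
    polarRadius V E θ = polarRadius V E θ' := by
  classical
  have : (fun r => 0 < r ∧ ham V (r * cos θ) (r * sin θ) = E)
      = fun r => 0 < r ∧ ham V (r * cos θ') (r * sin θ') = E := by simp only [h]
  exact congrArg (fun P : ℝ → Prop => if h : ∃ r, P r then h.choose else 0) this

lemma polarRadius_neg (V : ℝ → ℝ) (E θ : ℝ) : polarRadius V E (-θ) = polarRadius V E θ :=
  polarRadius_congr V E fun r => by simp [ham]

lemma polarRadius_add_two_pi (V : ℝ → ℝ) (E θ : ℝ) :
    polarRadius V E (θ + 2 * π) = polarRadius V E θ :=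
  polarRadius_congr V E fun r => by simp

lemma continuousAt_polarRadius (hl : 1 ≤ l) (hV : GoodPotential l V) {E : ℝ} (hE : V 0 < E)
    (θ : ℝ) : ContinuousAt (fun q : ℝ × ℝ => polarRadius V q.1 q.2) (E, θ) := by
  obtain ⟨hr, hrE⟩ := polarRadius_spec hl hV hE θ
  have hray (s : ℝ) : Continuous fun q : ℝ × ℝ => ham V (s * cos q.2) (s * sin q.2) :=
    (continuous_ham hV).comp
      (by fun_prop : Continuous fun q : ℝ × ℝ => (s * cos q.2, s * sin q.2))
  have hpos : ∀ᶠ q : ℝ × ℝ in nhds (E, θ), V 0 < q.1 :=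
    continuous_fst.continuousAt.eventually_const_lt hE
  refine tendsto_order.2 ⟨fun s hs => ?_, fun s hs => ?_⟩
  · rcases lt_or_ge s 0 with h0 | h0
    · filter_upwards [hpos] with q hq
      exact h0.trans (polarRadius_spec hl hV hq q.2).1
    · have h1 : ham V (s * cos θ) (s * sin θ) < E := by
        rw [← hrE]; exact ham_ray_strictMonoOn hl hV θ h0 hr.le hs
      have h2 : ∀ᶠ q : ℝ × ℝ in nhds (E, θ), ham V (s * cos q.2) (s * sin q.2) < q.1 :=
        (hray s).continuousAt.eventually_lt continuous_fst.continuousAt h1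
      filter_upwards [hpos, h2] with q hq h2
      obtain ⟨h3, h4⟩ := polarRadius_spec hl hV hq q.2
      rw [← h4] at h2
      rw [h4] at h2
      exact (ham_ray_strictMonoOn hl hV q.2).lt_iff_lt h0 h3.le |>.1 (by simpa only [h4] using h2)
  · have h0 : 0 < s := hr.trans hs
    have h1 : E < ham V (s * cos θ) (s * sin θ) := by
      conv_lhs => rw [← hrE]
      exact ham_ray_strictMonoOn hl hV θ hr.le h0.le hs
    have h2 : ∀ᶠ q : ℝ × ℝ in nhds (E, θ), q.1 < ham V (s * cos q.2) (s * sin q.2) :=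
      continuous_fst.continuousAt.eventually_lt (hray s).continuousAt h1
    filter_upwards [hpos, h2] with q hq h2
    obtain ⟨h3, h4⟩ := polarRadius_spec hl hV hq q.2
    exact (ham_ray_strictMonoOn hl hV q.2).lt_iff_lt h3.le h0.le |>.1 (by simpa only [h4] using h2)

lemma hasDerivAt_polarRadius (hl : 1 ≤ l) (hV : GoodPotential l V) {E : ℝ} (hE : V 0 < E)
    (θ : ℝ) : HasDerivAt (fun e => polarRadius V e θ)
      (polarRadius V E θ / vir V (polarRadius V E θ * cos θ) (polarRadius V E θ * sin θ)) E := by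
  obtain ⟨hr, hrE⟩ := polarRadius_spec hl hV hE θ
  have hv := vir_pos hl hV (hE.trans_eq hrE.symm)
  set r := polarRadius V E θ with hrdef
  have hmul : (deriv V (r * cos θ) * cos θ + 2 * (r * sin θ) * sin θ) * r
      = vir V (r * cos θ) (r * sin θ) := by unfold vir; ring
  have hne : deriv V (r * cos θ) * cos θ + 2 * (r * sin θ) * sin θ ≠ 0 := by
    intro h0; rw [h0, zero_mul] at hmul; exact hv.ne hmul
  have hc : ContinuousAt (fun e => polarRadius V e θ) E :=
    (continuousAt_polarRadius hl hV hE θ).comp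
      (f := fun e : ℝ => (e, θ)) (by fun_prop)
  have := HasDerivAt.of_local_left_inverse hc (hasDerivAt_ham_ray hV θ r) hne
    ((lt_mem_nhds hE).mono fun e he => (polarRadius_spec hl hV he θ).2)
  refine this.congr_deriv ?_
  rw [← hmul]
  field_simp

lemma polarRadius_arg (hl : 1 ≤ l) (hV : GoodPotential l V) {x ξ θ r : ℝ} (hr : 0 < r)
    (hx : r * cos θ = x) (hξ : r * sin θ = ξ) : polarRadius V (ham V x ξ) θ = r :=
  polarRadius_eq hl hV hr (by rw [hx, hξ])

end Polar

/-! ### Averages and angular primitives along the energy levels -/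

section Level

variable {l : ℝ} {V : ℝ → ℝ} {a b : ℝ} {F : ℝ → ℝ → ℝ}

/-- The density `F(Rcos θ, Rsin θ) R²`, where `R` is the polar radius of the level `E`. -/
def levelDensity (V : ℝ → ℝ) (F : ℝ → ℝ → ℝ) (E θ : ℝ) : ℝ :=
  F (polarRadius V E θ * cos θ) (polarRadius V E θ * sin θ) * polarRadius V E θ ^ 2

/-- The integral of `F` over the level `E`. -/
def levelIntegral (V : ℝ → ℝ) (F : ℝ → ℝ → ℝ) (E : ℝ) : ℝ := ∫ t in (-π)..π, levelDensity V F E t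

/-- The integral of `F` over the part of the level through `(x, ξ)` between the positive `x`-axis
and `(x, ξ)`. -/
def anglePrimitive (V : ℝ → ℝ) (F : ℝ → ℝ → ℝ) (x ξ : ℝ) : ℝ :=
  ∫ t in (0 : ℝ)..Complex.arg ⟨x, ξ⟩, levelDensity V F (ham V x ξ) t

/-- The first order operator on phase space functions which corresponds to the derivative of
level integrals with respect to the energy. -/
def eulerOp (V : ℝ → ℝ) (a b : ℝ) (F : ℝ → ℝ → ℝ) (x ξ : ℝ) : ℝ :=
  (x * dX F x ξ + ξ * dXi F x ξ + 2 * F x ξ) * (virMod V a b x ξ)⁻¹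

lemma isSymbol_eulerOp (hl : 1 ≤ l) (hV : GoodPotential l V) (ha : V 0 < a) (hab : a < b) {n : ℝ}
    (hF : IsSymbol l n 0 F) : IsSymbol l (n - 2 * l) 0 (eulerOp V a b F) := by
  have h1 := (isSymbol_fst.mul hl hF.dX).mono hl (m' := n) (n' := 0) (by linarith) (by linarith)
  have h2 := ((isSymbol_snd hl).mul hl hF.dXi).mono hl (m' := n) (n' := 0)
    (by linarith) (by linarith)
  have h3 := ((isSymbol_const 2).mul hl hF).mono hl (m' := n) (n' := 0)
    (by linarith) (by linarith)
  exact (((h1.add h2).add h3).mul hl (isSymbol_virMod_inv hl hV ha hab)).mono hl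
    (by linarith) (by linarith)

lemma eulerOp_eq_zero (hV : GoodPotential l V) (h0 : ∀ x ξ, ham V x ξ < b → F x ξ = 0) {x ξ : ℝ}
    (h : ham V x ξ < b) : eulerOp V a b F x ξ = 0 := by
  have h1 : (fun x' => F x' ξ) =ᶠ[nhds x] fun _ => 0 := by
    have hc : Continuous fun x' => ham V x' ξ :=
      (continuous_ham hV).comp (by fun_prop : Continuous fun x' : ℝ => (x', ξ))
    filter_upwards [hc.continuousAt.eventually_lt_const h] with x' hx' using h0 _ _ hx'
  have h2 : (fun ξ' => F x ξ') =ᶠ[nhds ξ] fun _ => 0 := by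
    have hc : Continuous fun ξ' => ham V x ξ' :=
      (continuous_ham hV).comp (by fun_prop : Continuous fun ξ' : ℝ => (x, ξ'))
    filter_upwards [hc.continuousAt.eventually_lt_const h] with ξ' hξ' using h0 _ _ hξ'
  simp [eulerOp, dX, dXi, h1.deriv_eq, h2.deriv_eq, h0 x ξ h]

lemma levelDensity_eq_zero (hl : 1 ≤ l) (hV : GoodPotential l V)
    (h0 : ∀ x ξ, ham V x ξ < b → F x ξ = 0) {E : ℝ} (hE : E < b) (θ : ℝ) :
    levelDensity V F E θ = 0 := by
  unfold levelDensity
  rcases le_or_gt E (V 0) with h | h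
  · rw [polarRadius_of_le hl hV h]; simp
  · rw [h0 _ _ ((polarRadius_spec hl hV h θ).2.trans_lt hE), zero_mul]

lemma levelDensity_add_two_pi (V : ℝ → ℝ) (F : ℝ → ℝ → ℝ) (E : ℝ) :
    Function.Periodic (levelDensity V F E) (2 * π) := fun θ => by
  simp [levelDensity, polarRadius_add_two_pi]

lemma continuous_levelDensity (hl : 1 ≤ l) (hV : GoodPotential l V) (hb : V 0 < b)
    (hF : Smooth₂ F) (h0 : ∀ x ξ, ham V x ξ < b → F x ξ = 0) :
    Continuous (Function.uncurry (levelDensity V F)) := by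
  refine continuous_iff_continuousAt.2 fun ⟨E, θ⟩ => ?_
  rcases lt_or_ge E b with h | h
  · refine (continuousAt_const (y := (0 : ℝ))).congr ?_
    filter_upwards [(continuous_fst (X := ℝ) (Y := ℝ)).continuousAt.eventually_lt_const h]
      with q hq
    exact (levelDensity_eq_zero hl hV h0 hq q.2).symm
  · have hR := continuousAt_polarRadius hl hV (hb.trans_le h) θ
    have hc : ContinuousAt (fun q : ℝ × ℝ => cos q.2) (E, θ) := by fun_prop
    have hs : ContinuousAt (fun q : ℝ × ℝ => sin q.2) (E, θ) := by fun_prop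
    have hz : ContinuousAt (fun q : ℝ × ℝ =>
        (polarRadius V q.1 q.2 * cos q.2, polarRadius V q.1 q.2 * sin q.2)) (E, θ) :=
      (hR.mul hc).prodMk (hR.mul hs)
    exact (hF.continuous.continuousAt.comp hz).mul (hR.pow 2)

lemma hasDerivAt_levelDensity (hl : 1 ≤ l) (hV : GoodPotential l V) (ha : V 0 < a) (hab : a < b)
    (hF : Smooth₂ F) (h0 : ∀ x ξ, ham V x ξ < b → F x ξ = 0) (E θ : ℝ) :
    HasDerivAt (fun e => levelDensity V F e θ) (levelDensity V (eulerOp V a b F) E θ) E := by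
  have hb := ha.trans hab
  rcases lt_or_ge E b with h | h
  · rw [levelDensity_eq_zero hl hV (fun _ _ => eulerOp_eq_zero hV h0) h]
    refine (hasDerivAt_const E (0 : ℝ)).congr_of_eventuallyEq ?_
    filter_upwards [gt_mem_nhds h] with e he
    exact levelDensity_eq_zero hl hV h0 he θ
  · have hE := hb.trans_le h
    have hR := hasDerivAt_polarRadius hl hV hE θ
    obtain ⟨hr, hrE⟩ := polarRadius_spec hl hV hE θ
    have hv := vir_pos hl hV (hE.trans_eq hrE.symm)
    have hm := virMod_eq (a := a) (V := V) hab (h.trans_eq hrE.symm)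
    have h1 := (hF.hasFDerivAt (polarRadius V E θ * cos θ)
      (polarRadius V E θ * sin θ)).comp_hasDerivAt E
      ((hR.mul_const (cos θ)).prodMk (hR.mul_const (sin θ)))
    refine (h1.mul (hR.pow 2)).congr_deriv ?_
    simp only [levelDensity, eulerOp, hm, pairCLM_apply, Function.comp_apply, Pi.pow_apply]
    field_simp
    push_cast
    ring

lemma hasFDerivAt_levelIntegral (hl : 1 ≤ l) (hV : GoodPotential l V) (ha : V 0 < a) (hab : a < b)
    (hF : Smooth₂ F) (hF' : Smooth₂ (eulerOp V a b F))
    (h0 : ∀ x ξ, ham V x ξ < b → F x ξ = 0) (x ξ : ℝ) :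
    HasFDerivAt (fun q : ℝ × ℝ => levelIntegral V F (ham V q.1 q.2))
      (pairCLM (0 + deriv V x * levelIntegral V (eulerOp V a b F) (ham V x ξ))
        (0 + 2 * ξ * levelIntegral V (eulerOp V a b F) (ham V x ξ))) (x, ξ) := by
  have hb := ha.trans hab
  have h1 := hasDerivAt_integral_param (continuous_levelDensity hl hV hb hF h0)
    (continuous_levelDensity hl hV hb hF' fun _ _ => eulerOp_eq_zero hV h0)
    (hasDerivAt_levelDensity hl hV ha hab hF h0) (-π) π (ham V x ξ)
  refine (h1.comp_hasFDerivAt (x, ξ) (hasFDerivAt_ham hV x ξ)).congr_fderiv ?_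
  ext <;> simp [levelIntegral, mul_comm]

lemma levelIntegral_eulerOp_eq_zero (hl : 1 ≤ l) (hV : GoodPotential l V) (ha : V 0 < a)
    (hab : a < b) (hF : Smooth₂ F) (hF' : Smooth₂ (eulerOp V a b F))
    (h0 : ∀ x ξ, ham V x ξ < b → F x ξ = 0) (hJ : ∀ E, levelIntegral V F E = 0) (E : ℝ) :
    levelIntegral V (eulerOp V a b F) E = 0 := by
  have hb := ha.trans hab
  have h1 := hasDerivAt_integral_param (continuous_levelDensity hl hV hb hF h0)
    (continuous_levelDensity hl hV hb hF' fun _ _ => eulerOp_eq_zero hV h0)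
    (hasDerivAt_levelDensity hl hV ha hab hF h0) (-π) π E
  have h2 : (fun e => ∫ t in (-π)..π, levelDensity V F e t) = fun _ => 0 := funext hJ
  rw [h2] at h1
  exact h1.unique (hasDerivAt_const E 0)

lemma primitive_congr_angle (hl : 1 ≤ l) (hV : GoodPotential l V) (hb : V 0 < b)
    (hF : Smooth₂ F) (h0 : ∀ x ξ, ham V x ξ < b → F x ξ = 0) {E : ℝ}
    (hJ : levelIntegral V F E = 0) {θ θ' : ℝ} (h : (θ : Real.Angle) = θ') :
    ∫ t in (0 : ℝ)..θ, levelDensity V F E t = ∫ t in (0 : ℝ)..θ', levelDensity V F E t := by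
  have hc : Continuous (levelDensity V F E) :=
    (continuous_levelDensity hl hV hb hF h0).uncurry_left E
  have hp : Function.Periodic (fun θ => ∫ t in (0 : ℝ)..θ, levelDensity V F E t) (2 * π) := by
    intro θ
    have h1 := (levelDensity_add_two_pi V F E).intervalIntegral_add_eq θ (-π)
    rw [show -π + 2 * π = π by ring] at h1
    have h2 := integral_add_adjacent_intervals (hc.intervalIntegrable 0 θ)
      (hc.intervalIntegrable (μ := volume) θ (θ + 2 * π))
    rw [h1] at h2
    have h3 : ∫ t in (-π)..π, levelDensity V F E t = 0 := hJ
    simp only [← h2, h3, add_zero]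
  obtain ⟨k, hk⟩ := Real.Angle.angle_eq_iff_two_pi_dvd_sub.1 h
  have := hp.int_mul k θ'
  rw [show θ' + k * (2 * π) = θ by linarith] at this
  exact this

lemma hasFDerivAt_arg {x ξ : ℝ} (h : (⟨x, ξ⟩ : ℂ) ∈ Complex.slitPlane) :
    HasFDerivAt (fun q : ℝ × ℝ => Complex.arg ⟨q.1, q.2⟩)
      (pairCLM (-ξ / (x ^ 2 + ξ ^ 2)) (x / (x ^ 2 + ξ ^ 2))) (x, ξ) := by
  have h1 := (Complex.hasStrictFDerivAt_log_real h).hasFDerivAt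
  have h2 := Complex.imCLM.hasFDerivAt.comp _ h1
  have h3 := h2.comp (x, ξ) (Complex.equivRealProdCLM.symm.toContinuousLinearMap.hasFDerivAt
    (x := (x, ξ)))
  have h4 : (⇑Complex.imCLM ∘ Complex.log) ∘ ⇑Complex.equivRealProdCLM.symm
      = fun q : ℝ × ℝ => Complex.arg ⟨q.1, q.2⟩ := by
    funext q
    simp only [Function.comp_apply, Complex.equivRealProdCLM_symm_apply, Complex.imCLM_apply,
      Complex.log_im, ← Complex.mk_eq_add_mul_I]
  refine HasFDerivAt.congr_fderiv (h4 ▸ h3) ?_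
  ext <;> simp [Complex.inv_im, Complex.inv_re, Complex.normSq_apply, sq]

end Level

section AnglePrimitive

variable {l : ℝ} {V : ℝ → ℝ} {a b : ℝ} {F : ℝ → ℝ → ℝ}

lemma norm_mk_cos_arg (x ξ : ℝ) :
    ‖(⟨x, ξ⟩ : ℂ)‖ * cos (Complex.arg ⟨x, ξ⟩) = x ∧ ‖(⟨x, ξ⟩ : ℂ)‖ * sin (Complex.arg ⟨x, ξ⟩) = ξ :=
  ⟨Complex.norm_mul_cos_arg _, Complex.norm_mul_sin_arg _⟩

lemma norm_mk_sq (x ξ : ℝ) : ‖(⟨x, ξ⟩ : ℂ)‖ ^ 2 = x ^ 2 + ξ ^ 2 := by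
  rw [Complex.sq_norm, Complex.normSq_mk]; ring

lemma norm_mk_pos {x ξ : ℝ} (h : (⟨x, ξ⟩ : ℂ) ≠ 0) : 0 < ‖(⟨x, ξ⟩ : ℂ)‖ := norm_pos_iff.2 h

lemma levelDensity_of_polar (hl : 1 ≤ l) (hV : GoodPotential l V) {x ξ θ r : ℝ} (hr : 0 < r)
    (hx : r * cos θ = x) (hξ : r * sin θ = ξ) :
    levelDensity V F (ham V x ξ) θ = F x ξ * r ^ 2 := by
  rw [levelDensity, polarRadius_arg hl hV hr hx hξ, hx, hξ]

lemma hasFDerivAt_primitive_chart (hl : 1 ≤ l) (hV : GoodPotential l V) (ha : V 0 < a)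
    (hab : a < b) (hF : Smooth₂ F) (hF' : Smooth₂ (eulerOp V a b F))
    (h0 : ∀ x ξ, ham V x ξ < b → F x ξ = 0) {x ξ : ℝ} {φ : ℝ × ℝ → ℝ} (hz : (⟨x, ξ⟩ : ℂ) ≠ 0)
    (hφ : HasFDerivAt φ (pairCLM (-ξ / (x ^ 2 + ξ ^ 2)) (x / (x ^ 2 + ξ ^ 2))) (x, ξ))
    (hang : (φ (x, ξ) : Real.Angle) = Complex.arg ⟨x, ξ⟩) :
    HasFDerivAt (fun q => ∫ t in (0 : ℝ)..φ q, levelDensity V F (ham V q.1 q.2) t)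
      (pairCLM
        (-ξ * F x ξ + deriv V x *
          ∫ t in (0 : ℝ)..φ (x, ξ), levelDensity V (eulerOp V a b F) (ham V x ξ) t)
        (x * F x ξ + 2 * ξ *
          ∫ t in (0 : ℝ)..φ (x, ξ), levelDensity V (eulerOp V a b F) (ham V x ξ) t)) (x, ξ) := by
  have hb := ha.trans hab
  have h1 := hasFDerivAt_primitive (continuous_levelDensity hl hV hb hF h0)
    (continuous_levelDensity hl hV hb hF' fun _ _ => eulerOp_eq_zero hV h0)
    (hasDerivAt_levelDensity hl hV ha hab hF h0) (ham V x ξ) (φ (x, ξ))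
  have h2 := h1.comp (x, ξ) ((hasFDerivAt_ham hV x ξ).prodMk hφ)
  have hr := norm_mk_pos hz
  have hr2 := norm_mk_sq x ξ
  have hD : levelDensity V F (ham V x ξ) (φ (x, ξ)) = F x ξ * (x ^ 2 + ξ ^ 2) := by
    rw [← hr2]
    refine levelDensity_of_polar hl hV hr ?_ ?_
    · rw [← Real.Angle.cos_coe, hang, Real.Angle.cos_coe, (norm_mk_cos_arg x ξ).1]
    · rw [← Real.Angle.sin_coe, hang, Real.Angle.sin_coe, (norm_mk_cos_arg x ξ).2]
  have hne : x ^ 2 + ξ ^ 2 ≠ 0 := by rw [← hr2]; positivity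
  refine h2.congr_fderiv ?_
  rw [hD]
  ext <;> simp <;> field_simp <;> ring

lemma hasFDerivAt_anglePrimitive (hl : 1 ≤ l) (hV : GoodPotential l V) (ha : V 0 < a)
    (hab : a < b) (hF : Smooth₂ F) (hF' : Smooth₂ (eulerOp V a b F))
    (h0 : ∀ x ξ, ham V x ξ < b → F x ξ = 0) (hJ : ∀ E, levelIntegral V F E = 0) (x ξ : ℝ) :
    HasFDerivAt (fun q : ℝ × ℝ => anglePrimitive V F q.1 q.2)
      (pairCLM (-ξ * F x ξ + deriv V x * anglePrimitive V (eulerOp V a b F) x ξ)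
        (x * F x ξ + 2 * ξ * anglePrimitive V (eulerOp V a b F) x ξ)) (x, ξ) := by
  have hb := ha.trans hab
  have h0' : ∀ x ξ, ham V x ξ < b → eulerOp V a b F x ξ = 0 := fun _ _ => eulerOp_eq_zero hV h0
  rcases lt_or_ge (ham V x ξ) b with h | h
  · have hzero : ∀ G : ℝ → ℝ → ℝ, (∀ x ξ, ham V x ξ < b → G x ξ = 0) →
        ∀ x ξ, ham V x ξ < b → anglePrimitive V G x ξ = 0 := fun G hG x ξ h => by
      simp [anglePrimitive, levelDensity_eq_zero hl hV hG h]
    rw [hzero _ h0' x ξ h, h0 x ξ h]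
    refine ((hasFDerivAt_const (0 : ℝ) (x, ξ)).congr_fderiv ?_).congr_of_eventuallyEq ?_
    · ext <;> simp
    · filter_upwards [(continuous_ham hV).continuousAt.eventually_lt_const h] with q hq
      exact hzero F h0 _ _ hq
  · have hz : (⟨x, ξ⟩ : ℂ) ≠ 0 := by
      intro hz
      obtain ⟨rfl, rfl⟩ := Complex.ext_iff.1 hz
      simp [ham] at h
      linarith
    rcases Complex.mem_slitPlane_or_neg_mem_slitPlane hz with hs | hs
    · exact hasFDerivAt_primitive_chart hl hV ha hab hF hF' h0 hz (hasFDerivAt_arg hs) rfl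
    · have hneg (q : ℝ × ℝ) : (⟨-q.1, -q.2⟩ : ℂ) = -⟨q.1, q.2⟩ := rfl
      have hang {q : ℝ × ℝ} (hq : (⟨q.1, q.2⟩ : ℂ) ≠ 0) :
          ((Complex.arg ⟨-q.1, -q.2⟩ + π : ℝ) : Real.Angle) = Complex.arg ⟨q.1, q.2⟩ := by
        rw [hneg, Real.Angle.coe_add, Complex.arg_neg_coe_angle hq, add_assoc,
          Real.Angle.coe_pi_add_coe_pi, add_zero]
      have harg : HasFDerivAt (fun q : ℝ × ℝ => Complex.arg ⟨-q.1, -q.2⟩ + π)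
          (pairCLM (-ξ / (x ^ 2 + ξ ^ 2)) (x / (x ^ 2 + ξ ^ 2))) (x, ξ) := by
        have h1 := hasFDerivAt_arg (x := -x) (ξ := -ξ) (by rw [hneg (x, ξ)]; exact hs)
        have h2 := (h1.comp (x, ξ) (hasFDerivAt_id (𝕜 := ℝ) (x, ξ)).neg).add_const π
        refine HasFDerivAt.congr_fderiv (f := fun q : ℝ × ℝ => Complex.arg ⟨-q.1, -q.2⟩ + π)
          h2 ?_
        ext <;> simp [neg_div]
      have h1 := hasFDerivAt_primitive_chart hl hV ha hab hF hF' h0 hz harg (hang (q := (x, ξ)) hz)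
      have hQ : anglePrimitive V (eulerOp V a b F) x ξ
          = ∫ t in (0 : ℝ)..Complex.arg ⟨-x, -ξ⟩ + π,
            levelDensity V (eulerOp V a b F) (ham V x ξ) t :=
        (primitive_congr_angle hl hV hb hF' h0'
          (levelIntegral_eulerOp_eq_zero hl hV ha hab hF hF' h0 hJ _) (hang (q := (x, ξ)) hz)).symm
      rw [hQ]
      refine h1.congr_of_eventuallyEq ?_
      have hc : Continuous fun q : ℝ × ℝ => (⟨q.1, q.2⟩ : ℂ) := by
        simp only [Complex.mk_eq_add_mul_I]; fun_prop
      filter_upwards [hc.continuousAt.eventually_ne (x := (x, ξ)) hz] with q hq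
      exact (primitive_congr_angle hl hV hb hF h0 (hJ _) (hang hq)).symm

end AnglePrimitive

/-! ### Bounds for level integrals -/

lemma ellipse_pos {A B : ℝ} (hA : 0 < A) (hB : 0 < B) (θ : ℝ) :
    0 < cos θ ^ 2 / A ^ 2 + sin θ ^ 2 / B ^ 2 := by
  by_cases h : cos θ = 0
  · have : sin θ ^ 2 = 1 := by have := Real.sin_sq_add_cos_sq θ; rw [h] at this; linarith
    rw [h, this]; positivity
  · positivity

lemma continuous_ellipse_inv {A B : ℝ} (hA : 0 < A) (hB : 0 < B) :
    Continuous fun θ => (cos θ ^ 2 / A ^ 2 + sin θ ^ 2 / B ^ 2)⁻¹ :=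
  Continuous.inv₀ (by fun_prop) fun θ => (ellipse_pos hA hB θ).ne'

lemma integral_ellipse_inv {A B : ℝ} (hA : 0 < A) (hB : 0 < B) :
    ∫ θ in (-π)..π, (cos θ ^ 2 / A ^ 2 + sin θ ^ 2 / B ^ 2)⁻¹ = 2 * π * (A * B) := by
  set e := fun θ => (cos θ ^ 2 / A ^ 2 + sin θ ^ 2 / B ^ 2)⁻¹ with he
  have hec : Continuous e := continuous_ellipse_inv hA hB
  have hder : ∀ θ ∈ Set.uIcc (-(π / 2)) (π / 2),
      HasDerivAt (fun θ => A * B * Complex.arg ⟨B * cos θ, A * sin θ⟩) (e θ) θ := by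
    intro θ hθ
    rw [Set.uIcc_of_le (by linarith [Real.pi_pos])] at hθ
    have hmem : (⟨B * cos θ, A * sin θ⟩ : ℂ) ∈ Complex.slitPlane := by
      rw [Complex.mem_slitPlane_iff]
      rcases (Real.cos_nonneg_of_mem_Icc hθ).eq_or_lt with h | h
      · refine Or.inr (mul_ne_zero hA.ne' fun hs => ?_)
        have := Real.sin_sq_add_cos_sq θ
        simp [hs, ← h] at this
      · exact Or.inl (mul_pos hB h)
    have h1 := ((hasFDerivAt_arg hmem).comp_hasDerivAt θ
      (((Real.hasDerivAt_cos θ).const_mul B).prodMk ((Real.hasDerivAt_sin θ).const_mul A))).const_mul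
        (A * B)
    refine h1.congr_deriv ?_
    have hpos := ellipse_pos hA hB θ
    have hne : (B * cos θ) ^ 2 + (A * sin θ) ^ 2 ≠ 0 := by
      have : (B * cos θ) ^ 2 + (A * sin θ) ^ 2
          = A ^ 2 * B ^ 2 * (cos θ ^ 2 / A ^ 2 + sin θ ^ 2 / B ^ 2) := by field_simp
      rw [this]; positivity
    have e1 : e θ = A ^ 2 * B ^ 2 / ((B * cos θ) ^ 2 + (A * sin θ) ^ 2) := by
      rw [he]
      simp only
      rw [inv_eq_one_div, div_eq_div_iff hpos.ne' hne]
      field_simp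
    rw [e1]
    simp only [pairCLM_apply]
    field_simp
    linear_combination ((B * cos θ) ^ 2 + (A * sin θ) ^ 2)⁻¹ * Real.sin_sq_add_cos_sq θ
  have hhalf : ∫ θ in (-(π / 2))..(π / 2), e θ = π * (A * B) := by
    rw [integral_eq_sub_of_hasDerivAt hder (hec.intervalIntegrable _ _)]
    have h1 : Complex.arg ⟨B * cos (π / 2), A * sin (π / 2)⟩ = π / 2 := by
      rw [Complex.arg_eq_pi_div_two_iff]; simp [hA]
    have h2 : Complex.arg ⟨B * cos (-(π / 2)), A * sin (-(π / 2))⟩ = -(π / 2) := by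
      rw [Complex.arg_eq_neg_pi_div_two_iff]; simp [hA]
    rw [h1, h2]; ring
  have hper : Function.Periodic e π := fun θ => by simp [he]
  rw [← integral_add_adjacent_intervals (hec.intervalIntegrable (-π) 0)
    (hec.intervalIntegrable 0 π)]
  have h1 := hper.intervalIntegral_add_eq (-π) (-(π / 2))
  have h2 := hper.intervalIntegral_add_eq 0 (-(π / 2))
  rw [show -(π / 2) + π = π / 2 by ring] at h1 h2
  rw [neg_add_cancel] at h1
  rw [zero_add] at h2
  rw [h1, h2, hhalf]; ring

lemma exists_rpow_le {A B : ℝ} (hA : 0 < A) (hB : 0 < B) (s : ℝ) :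
    ∃ K, 0 < K ∧ ∀ x y, 0 < x → 0 < y → x ≤ A * y → y ≤ B * x → x ^ s ≤ K * y ^ s := by
  rcases le_total 0 s with hs | hs
  · refine ⟨A ^ s, by positivity, fun x y hx hy h _ => ?_⟩
    rw [← Real.mul_rpow hA.le hy.le]
    exact Real.rpow_le_rpow hx.le h hs
  · refine ⟨B⁻¹ ^ s, by positivity, fun x y hx hy _ h => ?_⟩
    rw [← Real.mul_rpow (by positivity) hy.le]
    refine Real.rpow_le_rpow_of_nonpos (by positivity) ?_ hs
    rw [inv_mul_le_iff₀ hB]; exact h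

section LevelBounds

variable {l : ℝ} {V : ℝ → ℝ} {b : ℝ} {F : ℝ → ℝ → ℝ}

lemma exists_wt_le_rpow (hl : 1 ≤ l) (hV : GoodPotential l V) (m : ℝ) :
    ∃ K, 0 < K ∧ ∀ x ξ, wt l m 0 x ξ ≤ K * (1 + (ham V x ξ - V 0)) ^ (m / (2 * l)) ∧
      (1 + (ham V x ξ - V 0)) ^ (m / (2 * l)) ≤ K * wt l m 0 x ξ := by
  obtain ⟨A, hA, h1⟩ := lam_le_ham hl hV
  obtain ⟨B, hB, h2⟩ := ham_le_lam hl hV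
  obtain ⟨K, hK, hK'⟩ := exists_rpow_le hA hB (m / (2 * l))
  obtain ⟨L, hL, hL'⟩ := exists_rpow_le hB hA (m / (2 * l))
  have hlam (x ξ : ℝ) : 0 < lam l x ξ ^ (2 * l) := Real.rpow_pos_of_pos (lam_pos hl _ _) _
  have hτ (x ξ : ℝ) : 0 < 1 + (ham V x ξ - V 0) := by linarith [min_le_ham hl hV x ξ]
  have e (x ξ : ℝ) : wt l m 0 x ξ = (lam l x ξ ^ (2 * l)) ^ (m / (2 * l)) := by
    rw [wt, Real.rpow_zero, mul_one, ← Real.rpow_mul (lam_pos hl x ξ).le]; congr 1; field_simp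
  refine ⟨max K L, by positivity, fun x ξ => ⟨?_, ?_⟩⟩
  · rw [e]
    exact (hK' _ _ (hlam x ξ) (hτ x ξ) (h1 x ξ) (h2 x ξ)).trans
      (mul_le_mul_of_nonneg_right (le_max_left _ _) (Real.rpow_nonneg (hτ x ξ).le _))
  · rw [e]
    exact (hL' _ _ (hτ x ξ) (hlam x ξ) (h2 x ξ) (h1 x ξ)).trans
      (mul_le_mul_of_nonneg_right (le_max_right _ _) (Real.rpow_nonneg (hlam x ξ).le _))

lemma exists_polarRadius_bounds (hl : 1 ≤ l) (hV : GoodPotential l V) (hb : V 0 < b) :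
    ∃ c C, 0 < c ∧ 0 < C ∧ ∀ E θ, b ≤ E →
      c * (cos θ ^ 2 / ((1 + (E - V 0)) ^ (1 / (2 * l))) ^ 2
          + sin θ ^ 2 / ((1 + (E - V 0)) ^ (1 / 2 : ℝ)) ^ 2)⁻¹ ≤ polarRadius V E θ ^ 2 ∧
      polarRadius V E θ ^ 2 ≤ C * (cos θ ^ 2 / ((1 + (E - V 0)) ^ (1 / (2 * l))) ^ 2
          + sin θ ^ 2 / ((1 + (E - V 0)) ^ (1 / 2 : ℝ)) ^ 2)⁻¹ := by
  obtain ⟨c, C, hc, hC, h⟩ := rescaled_level_bounds hl hV hb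
  refine ⟨c, C, hc, hC, fun E θ hE => ?_⟩
  obtain ⟨hr, hrE⟩ := polarRadius_spec hl hV (hb.trans_le hE) θ
  have hτ : 0 < 1 + (E - V 0) := by linarith
  have := h (polarRadius V E θ * cos θ) (polarRadius V E θ * sin θ) (hE.trans_eq hrE.symm)
  rw [hrE] at this
  have hp := ellipse_pos (Real.rpow_pos_of_pos hτ (1 / (2 * l)))
    (Real.rpow_pos_of_pos hτ (1 / 2 : ℝ)) θ
  have e : (polarRadius V E θ * cos θ) ^ 2 / ((1 + (E - V 0)) ^ (1 / (2 * l))) ^ 2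
      + (polarRadius V E θ * sin θ) ^ 2 / ((1 + (E - V 0)) ^ (1 / 2 : ℝ)) ^ 2
      = polarRadius V E θ ^ 2 * (cos θ ^ 2 / ((1 + (E - V 0)) ^ (1 / (2 * l))) ^ 2
          + sin θ ^ 2 / ((1 + (E - V 0)) ^ (1 / 2 : ℝ)) ^ 2) := by ring
  rw [e] at this
  rw [← div_eq_mul_inv, ← div_eq_mul_inv, div_le_iff₀ hp, le_div_iff₀ hp]
  exact this

lemma integral_ellipse_inv_rpow (hl : 1 ≤ l) {τ : ℝ} (hτ : 0 < τ) (m : ℝ) :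
    τ ^ (m / (2 * l)) *
      ∫ θ in (-π)..π, (cos θ ^ 2 / (τ ^ (1 / (2 * l))) ^ 2 + sin θ ^ 2 / (τ ^ (1 / 2 : ℝ)) ^ 2)⁻¹
      = 2 * π * τ ^ ((m + l + 1) / (2 * l)) := by
  rw [integral_ellipse_inv (by positivity) (by positivity), ← Real.rpow_add hτ]
  have : τ ^ (m / (2 * l)) * (2 * π * τ ^ (1 / (2 * l) + 1 / 2))
      = 2 * π * (τ ^ (m / (2 * l)) * τ ^ (1 / (2 * l) + 1 / 2)) := by ring
  rw [this, ← Real.rpow_add hτ]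
  congr 2
  field_simp
  ring

lemma exists_bound_integral_levelDensity (hl : 1 ≤ l) (hV : GoodPotential l V) (hb : V 0 < b)
    (h0 : ∀ x ξ, ham V x ξ < b → F x ξ = 0) {C m : ℝ}
    (hC : ∀ x ξ, |F x ξ| ≤ C * wt l m 0 x ξ) :
    ∃ K, ∀ x ξ c d, c ∈ Set.Icc (-π) π → d ∈ Set.Icc (-π) π →
      |∫ t in c..d, levelDensity V F (ham V x ξ) t| ≤ K * wt l (m + l + 1) 0 x ξ := by
  obtain ⟨A, hA, hwt⟩ := exists_wt_le_rpow hl hV m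
  obtain ⟨B, hB, hwt'⟩ := exists_wt_le_rpow hl hV (m + l + 1)
  obtain ⟨_, R, -, hR, hrad⟩ := exists_polarRadius_bounds hl hV hb
  have hC0 : 0 ≤ C := nonneg_of_mul_nonneg_left ((abs_nonneg _).trans (hC 0 0)) (wt_pos hl m 0 0 0)
  refine ⟨C * A * R * (2 * π) * B, fun x ξ c d hc hd => ?_⟩
  have hw := wt_pos hl (m + l + 1) 0 x ξ
  set E := ham V x ξ with hEdef
  rcases lt_or_ge E b with hE | hE
  · have := Real.pi_pos
    have h : ∫ t in c..d, levelDensity V F E t = 0 := by simp [levelDensity_eq_zero hl hV h0 hE]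
    rw [h, abs_zero]
    positivity
  set τ := 1 + (E - V 0) with hτdef
  have hτ : 0 < τ := by linarith
  set e := fun θ => (cos θ ^ 2 / (τ ^ (1 / (2 * l))) ^ 2 + sin θ ^ 2 / (τ ^ (1 / 2 : ℝ)) ^ 2)⁻¹
    with he
  have hec : Continuous e := continuous_ellipse_inv (by positivity) (by positivity)
  have he0 (θ : ℝ) : 0 < e θ := inv_pos.2 (ellipse_pos (by positivity) (by positivity) θ)
  set D := C * A * τ ^ (m / (2 * l)) * R with hD
  have hD0 : 0 ≤ D := by positivity
  have hpt (θ : ℝ) : ‖levelDensity V F E θ‖ ≤ D * e θ := by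
    have hrE := (polarRadius_spec hl hV (hb.trans_le hE) θ).2
    rw [levelDensity, Real.norm_eq_abs, abs_mul, abs_of_nonneg (sq_nonneg (polarRadius V E θ))]
    have h1 := (hC _ _).trans (mul_le_mul_of_nonneg_left
      (hwt (polarRadius V E θ * cos θ) (polarRadius V E θ * sin θ)).1 hC0)
    rw [hrE] at h1
    refine (mul_le_mul h1 (hrad E θ hE).2 (sq_nonneg _) (by positivity)).trans_eq ?_
    rw [hD, he]; ring
  have h_int : IntegrableOn (fun θ => D * e θ) (Set.Ioc (-π) π) :=
    ((continuous_const.mul hec).integrableOn_Icc).mono_set Set.Ioc_subset_Icc_self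
  have hsub : Set.uIoc c d ⊆ Set.Ioc (-π) π := fun t ht => by
    rcases Set.mem_uIoc.1 ht with h | h
    · exact ⟨hc.1.trans_lt h.1, h.2.trans hd.2⟩
    · exact ⟨hd.1.trans_lt h.1, h.2.trans hc.2⟩
  calc |∫ t in c..d, levelDensity V F E t|
      ≤ ∫ t in Set.uIoc c d, D * e t :=
        (norm_integral_le_integral_norm_uIoc).trans
          (integral_mono_of_nonneg (Filter.Eventually.of_forall fun _ => norm_nonneg _)
            (h_int.mono_set hsub) (Filter.Eventually.of_forall hpt))
    _ ≤ ∫ t in Set.Ioc (-π) π, D * e t :=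
        setIntegral_mono_set h_int
          (Filter.Eventually.of_forall fun t => mul_nonneg hD0 (he0 t).le)
          hsub.eventuallyLE
    _ = ∫ t in (-π)..π, D * e t := (integral_of_le (by linarith [Real.pi_pos])).symm
    _ = C * A * R * (τ ^ (m / (2 * l)) * ∫ t in (-π)..π, e t) := by
        rw [intervalIntegral.integral_const_mul, hD]; ring
    _ = C * A * R * (2 * π) * τ ^ ((m + l + 1) / (2 * l)) := by
        rw [he, integral_ellipse_inv_rpow hl hτ]; ring
    _ ≤ C * A * R * (2 * π) * (B * wt l (m + l + 1) 0 x ξ) :=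
        mul_le_mul_of_nonneg_left (hwt' x ξ).2 (by positivity)
    _ = _ := by ring

lemma exists_lower_bound_levelIntegral (hl : 1 ≤ l) (hV : GoodPotential l V) (hb : V 0 < b)
    (hcont : Continuous (Function.uncurry (levelDensity V F))) {c m : ℝ} (hc : 0 < c)
    (hF : ∀ x ξ, b ≤ ham V x ξ → c * wt l m 0 x ξ ≤ F x ξ) :
    ∃ k, 0 < k ∧ ∀ x ξ, b ≤ ham V x ξ →
      k * wt l (m + l + 1) 0 x ξ ≤ levelIntegral V F (ham V x ξ) := by
  obtain ⟨A, hA, hwt⟩ := exists_wt_le_rpow hl hV m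
  obtain ⟨B, hB, hwt'⟩ := exists_wt_le_rpow hl hV (m + l + 1)
  obtain ⟨R, _, hR, -, hrad⟩ := exists_polarRadius_bounds hl hV hb
  have hpi := Real.pi_pos
  refine ⟨c * A⁻¹ * R * (2 * π) * B⁻¹, by positivity, fun x ξ hE => ?_⟩
  set E := ham V x ξ with hEdef
  set τ := 1 + (E - V 0) with hτdef
  have hτ : 0 < τ := by linarith
  set e := fun θ => (cos θ ^ 2 / (τ ^ (1 / (2 * l))) ^ 2 + sin θ ^ 2 / (τ ^ (1 / 2 : ℝ)) ^ 2)⁻¹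
    with he
  have hec : Continuous e := continuous_ellipse_inv (by positivity) (by positivity)
  have he0 (θ : ℝ) : 0 < e θ := inv_pos.2 (ellipse_pos (by positivity) (by positivity) θ)
  set D := c * A⁻¹ * τ ^ (m / (2 * l)) * R with hD
  have hpt (θ : ℝ) : D * e θ ≤ levelDensity V F E θ := by
    have hrE := (polarRadius_spec hl hV (hb.trans_le hE) θ).2
    have h1 := (hwt (polarRadius V E θ * cos θ) (polarRadius V E θ * sin θ)).2
    have h2 := hF _ _ (hE.trans_eq hrE.symm)
    rw [hrE] at h1
    have h3 : c * A⁻¹ * τ ^ (m / (2 * l))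
        ≤ F (polarRadius V E θ * cos θ) (polarRadius V E θ * sin θ) := by
      refine le_trans ?_ h2
      rw [mul_assoc]
      refine mul_le_mul_of_nonneg_left ?_ hc.le
      rwa [inv_mul_le_iff₀ hA]
    refine le_trans (le_of_eq ?_) (mul_le_mul h3 (hrad E θ hE).1
      (mul_nonneg hR.le (he0 θ).le) (le_trans (by positivity) h3))
    rw [hD, he]; ring
  calc c * A⁻¹ * R * (2 * π) * B⁻¹ * wt l (m + l + 1) 0 x ξ
      = c * A⁻¹ * R * (2 * π) * (B⁻¹ * wt l (m + l + 1) 0 x ξ) := by ring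
    _ ≤ c * A⁻¹ * R * (2 * π) * τ ^ ((m + l + 1) / (2 * l)) := by
        refine mul_le_mul_of_nonneg_left ?_ (by positivity)
        rw [inv_mul_le_iff₀ hB]; exact (hwt' x ξ).1
    _ = ∫ t in (-π)..π, D * e t := by
        have := integral_ellipse_inv_rpow hl hτ m
        rw [intervalIntegral.integral_const_mul, hD]
        linear_combination -(c * A⁻¹ * R) * this
    _ ≤ _ := integral_mono (by linarith) ((continuous_const.mul hec).intervalIntegrable _ _)
        ((hcont.uncurry_left E).intervalIntegrable _ _) hpt

end LevelBounds

/-! ### Symbol classes of averages and angular primitives -/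

section SymbolClasses

variable {l : ℝ} {V : ℝ → ℝ} {a b m : ℝ} {F : ℝ → ℝ → ℝ}

lemma isSymbol_iterate_eulerOp (hl : 1 ≤ l) (hV : GoodPotential l V) (ha : V 0 < a) (hab : a < b)
    (hF : IsSymbol l m 0 F) (k : ℕ) :
    IsSymbol l (m - 2 * l * k) 0 ((eulerOp V a b)^[k] F) := by
  induction k with
  | zero => simpa using hF
  | succ k ih =>
    rw [Function.iterate_succ_apply']
    convert isSymbol_eulerOp hl hV ha hab ih using 1
    push_cast; ring

lemma iterate_eulerOp_eq_zero (hV : GoodPotential l V) (h0 : ∀ x ξ, ham V x ξ < b → F x ξ = 0)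
    (k : ℕ) : ∀ x ξ, ham V x ξ < b → (eulerOp V a b)^[k] F x ξ = 0 := by
  induction k with
  | zero => simpa using h0
  | succ k ih =>
    rw [Function.iterate_succ_apply']
    exact fun x ξ h => eulerOp_eq_zero hV ih h

lemma isSymbol_levelIntegral (hl : 1 ≤ l) (hV : GoodPotential l V) (ha : V 0 < a) (hab : a < b)
    (hF : IsSymbol l m 0 F) (h0 : ∀ x ξ, ham V x ξ < b → F x ξ = 0) :
    IsSymbol l (m + l + 1) 0 fun x ξ => levelIntegral V F (ham V x ξ) := by
  have hs := isSymbol_iterate_eulerOp hl hV ha hab hF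
  have hz (k : ℕ) := iterate_eulerOp_eq_zero (a := a) hV h0 k
  have hzero (n : ℝ) : IsSymbol l n 0 fun _ _ => 0 := by
    have := (isSymbol_one_sub_energyCutoff hl hV hab n 0).mul hl (isSymbol_const (l := l) 0)
    simpa using this
  refine (isSymbol_of_rec hl hV
    (u := fun k x ξ => levelIntegral V ((eulerOp V a b)^[k] F) (ham V x ξ))
    (fun k => hzero _) (fun k => hzero _) (fun k => ?_) fun k x ξ => ?_).1
  · obtain ⟨C, hC⟩ := ((hs k).sym 0).bound
    obtain ⟨K, hK⟩ := exists_bound_integral_levelDensity hl hV (ha.trans hab) (hz k) hC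
    refine ⟨K, fun x ξ => ?_⟩
    have := hK x ξ (-π) π ⟨le_rfl, by linarith [Real.pi_pos]⟩ ⟨by linarith [Real.pi_pos], le_rfl⟩
    rwa [show m - 2 * l * k + l + 1 = m + l + 1 - 2 * l * k by ring] at this
  · have h2 := (hs (k + 1)).smooth
    simp only [Function.iterate_succ_apply'] at h2 ⊢
    exact hasFDerivAt_levelIntegral hl hV ha hab (hs k).smooth h2 (hz k) x ξ

lemma isSymbol_anglePrimitive (hl : 1 ≤ l) (hV : GoodPotential l V) (ha : V 0 < a) (hab : a < b)
    (hF : IsSymbol l m 0 F) (h0 : ∀ x ξ, ham V x ξ < b → F x ξ = 0)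
    (hJ : ∀ E, levelIntegral V F E = 0) :
    IsSymbol l (m + l + 1) 0 (anglePrimitive V F) ∧
      IsSymbol l (m + l) 0 (dX (anglePrimitive V F)) := by
  have hs := isSymbol_iterate_eulerOp hl hV ha hab hF
  have hz (k : ℕ) := iterate_eulerOp_eq_zero (a := a) hV h0 k
  have hJk (k : ℕ) : ∀ E, levelIntegral V ((eulerOp V a b)^[k] F) E = 0 := by
    induction k with
    | zero => simpa using hJ
    | succ k ih =>
      have h2 := (hs (k + 1)).smooth
      rw [Function.iterate_succ_apply'] at h2 ⊢
      exact levelIntegral_eulerOp_eq_zero hl hV ha hab (hs k).smooth h2 (hz k) ih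
  have key := isSymbol_of_rec hl hV (n := m + l + 1)
    (u := fun k => anglePrimitive V ((eulerOp V a b)^[k] F))
    (α := fun k x ξ => -ξ * (eulerOp V a b)^[k] F x ξ)
    (β := fun k x ξ => x * (eulerOp V a b)^[k] F x ξ) (fun k => ?_) (fun k => ?_) (fun k => ?_)
    fun k x ξ => ?_
  · rw [show m + l + 1 - 1 = m + l by ring] at key
    exact key
  · have := ((isSymbol_const (-1)).mul hl (isSymbol_snd hl)).mul hl (hs k)
    simp only [neg_one_mul] at this
    exact this.mono hl (by linarith) (by linarith)
  · exact (isSymbol_fst.mul hl (hs k)).mono hl (by linarith) (by linarith)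
  · obtain ⟨C, hC⟩ := ((hs k).sym 0).bound
    obtain ⟨K, hK⟩ := exists_bound_integral_levelDensity hl hV (ha.trans hab) (hz k) hC
    refine ⟨K, fun x ξ => ?_⟩
    have := hK x ξ 0 (Complex.arg ⟨x, ξ⟩) ⟨by linarith [Real.pi_pos], Real.pi_pos.le⟩
      ⟨(Complex.neg_pi_lt_arg _).le, Complex.arg_le_pi _⟩
    rwa [show m - 2 * l * k + l + 1 = m + l + 1 - 2 * l * k by ring] at this
  · have h2 := (hs (k + 1)).smooth
    simp only [Function.iterate_succ_apply'] at h2 ⊢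
    exact hasFDerivAt_anglePrimitive hl hV ha hab (hs k).smooth h2 (hz k) (hJk k) x ξ

end SymbolClasses

/-! ### Level integrals in the position variable -/

section TurningPoint

variable {l : ℝ} {V qM : ℝ → ℝ} {F g : ℝ → ℝ → ℝ} {E : ℝ}

lemma IsTurningPoint.lt_iff (hqM : IsTurningPoint V qM) (hl : 1 ≤ l) (hV : GoodPotential l V)
    (hE : V 0 < E) {q : ℝ} : V q < E ↔ q ∈ Set.Ioo (-(qM E)) (qM E) := by
  obtain ⟨hQ, hQE, -⟩ := hqM E hE
  rw [Set.mem_Ioo, ← abs_lt, ← hV.apply_abs q]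
  nth_rw 1 [← hQE]
  exact (hV.strictMonoOn hl).lt_iff_lt (abs_nonneg q) hQ.le

lemma hasDerivAt_arg_level (hV : GoodPotential l V) {q : ℝ} (hq : V q < E) :
    HasDerivAt (fun q => Complex.arg ⟨q, √(E - V q)⟩)
      (-(vir V q √(E - V q) / (2 * √(E - V q) * (q ^ 2 + √(E - V q) ^ 2)))) q := by
  have hs : 0 < √(E - V q) := Real.sqrt_pos.2 (sub_pos.2 hq)
  have h1 := ((hV.differentiable q).hasDerivAt.const_sub E).sqrt (sub_pos.2 hq).ne'
  have hmem : (⟨q, √(E - V q)⟩ : ℂ) ∈ Complex.slitPlane :=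
    Complex.mem_slitPlane_iff.2 (Or.inr hs.ne')
  refine ((hasFDerivAt_arg hmem).comp_hasDerivAt q ((hasDerivAt_id q).prodMk h1)).congr_deriv ?_
  have : 0 < q ^ 2 + √(E - V q) ^ 2 := by positivity
  simp only [pairCLM_apply, vir]
  field_simp
  ring

lemma arg_image_Ioo (hl : 1 ≤ l) (hV : GoodPotential l V) (hqM : IsTurningPoint V qM)
    (hE : V 0 < E) :
    (fun q => Complex.arg ⟨q, √(E - V q)⟩) '' Set.Ioo (-(qM E)) (qM E) = Set.Ioo 0 π := by
  ext θ
  constructor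
  · rintro ⟨q, hq, rfl⟩
    have hs : 0 < √(E - V q) := Real.sqrt_pos.2 (sub_pos.2 ((hqM.lt_iff hl hV hE).2 hq))
    have hz : (⟨q, √(E - V q)⟩ : ℂ) ≠ 0 := fun h => hs.ne' (congrArg Complex.im h)
    have hsin : 0 < sin (Complex.arg ⟨q, √(E - V q)⟩) := by
      rw [Complex.sin_arg]; exact div_pos hs (norm_mk_pos hz)
    constructor
    · by_contra! h
      exact hsin.not_ge (Real.sin_nonpos_of_nonpos_of_neg_pi_le h (Complex.neg_pi_lt_arg _).le)
    · refine (Complex.arg_le_pi _).lt_of_ne fun h => ?_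
      rw [h, Real.sin_pi] at hsin
      exact hsin.false
  · intro hθ
    obtain ⟨hr, hrE⟩ := polarRadius_spec hl hV hE θ
    have hs := mul_pos hr (Real.sin_pos_of_mem_Ioo hθ)
    have hsq : E - V (polarRadius V E θ * cos θ) = (polarRadius V E θ * sin θ) ^ 2 := by
      rw [ham] at hrE; linarith
    refine ⟨polarRadius V E θ * cos θ, (hqM.lt_iff hl hV hE).1 ?_, ?_⟩
    · have := pow_pos hs 2; linarith
    · simp only
      rw [hsq, Real.sqrt_sq hs.le]
      have := Complex.arg_mul_cos_add_sin_mul_I hr ⟨by linarith [hθ.1, Real.pi_pos], hθ.2.le⟩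
      convert this using 2
      apply Complex.ext <;> simp [← Complex.ofReal_cos, ← Complex.ofReal_sin]

lemma integral_levelDensity_zero_pi (hl : 1 ≤ l) (hV : GoodPotential l V)
    (hqM : IsTurningPoint V qM) (hE : V 0 < E) (hc : Continuous (levelDensity V F E))
    (hg : ∀ x ξ, ham V x ξ = E → vir V x ξ * F x ξ = g x ξ) :
    IntervalIntegrable (fun q => g q √(E - V q) / √(E - V q)) volume (-(qM E)) (qM E) ∧
      ∫ q in (-(qM E))..(qM E), g q √(E - V q) / √(E - V q)
        = 2 * ∫ t in (0 : ℝ)..π, levelDensity V F E t := by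
  obtain ⟨hQ, -, -⟩ := hqM E hE
  have hder : ∀ q ∈ Set.Ioo (-(qM E)) (qM E),
      HasDerivWithinAt (fun q => Complex.arg ⟨q, √(E - V q)⟩)
        (-(vir V q √(E - V q) / (2 * √(E - V q) * (q ^ 2 + √(E - V q) ^ 2))))
        (Set.Ioo (-(qM E)) (qM E)) q := fun q hq =>
    (hasDerivAt_arg_level hV ((hqM.lt_iff hl hV hE).2 hq)).hasDerivWithinAt
  have hham {q : ℝ} (hq : q ∈ Set.Ioo (-(qM E)) (qM E)) : ham V q √(E - V q) = E := by
    rw [ham, Real.sq_sqrt (sub_pos.2 ((hqM.lt_iff hl hV hE).2 hq)).le]; ring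
  have hspos {q : ℝ} (hq : q ∈ Set.Ioo (-(qM E)) (qM E)) : 0 < √(E - V q) :=
    Real.sqrt_pos.2 (sub_pos.2 ((hqM.lt_iff hl hV hE).2 hq))
  have hz {q : ℝ} (hq : q ∈ Set.Ioo (-(qM E)) (qM E)) : (⟨q, √(E - V q)⟩ : ℂ) ≠ 0 :=
    fun h => (hspos hq).ne' (congrArg Complex.im h)
  have hinj : Set.InjOn (fun q => Complex.arg ⟨q, √(E - V q)⟩) (Set.Ioo (-(qM E)) (qM E)) := by
    intro q hq q' hq' h
    have hR {q : ℝ} (hq : q ∈ Set.Ioo (-(qM E)) (qM E)) :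
        polarRadius V E (Complex.arg ⟨q, √(E - V q)⟩) * cos (Complex.arg ⟨q, √(E - V q)⟩) = q := by
      have := polarRadius_arg hl hV (norm_mk_pos (hz hq)) (norm_mk_cos_arg q √(E - V q)).1
        (norm_mk_cos_arg q √(E - V q)).2
      rw [hham hq] at this
      rw [this, (norm_mk_cos_arg _ _).1]
    simp only at h
    rw [← hR hq, ← hR hq', h]
  have hpt : ∀ q ∈ Set.Ioo (-(qM E)) (qM E),
      |-(vir V q √(E - V q) / (2 * √(E - V q) * (q ^ 2 + √(E - V q) ^ 2)))| •
        levelDensity V F E (Complex.arg ⟨q, √(E - V q)⟩)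
        = (g q √(E - V q) / √(E - V q)) * 2⁻¹ := by
    intro q hq
    have h1 := levelDensity_of_polar (F := F) hl hV (norm_mk_pos (hz hq))
      (norm_mk_cos_arg q √(E - V q)).1 (norm_mk_cos_arg q √(E - V q)).2
    rw [hham hq, norm_mk_sq] at h1
    have hs := hspos hq
    rw [h1, ← hg _ _ (hham hq), abs_neg, abs_of_nonneg
      (div_nonneg (vir_nonneg hl hV _ _) (by positivity)), smul_eq_mul]
    have : 0 < q ^ 2 + √(E - V q) ^ 2 := by positivity
    field_simp
  have h_int := (integrableOn_image_iff_integrableOn_abs_deriv_smul measurableSet_Ioo hder hinj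
    (levelDensity V F E)).1
  have hval := integral_image_eq_integral_abs_deriv_smul measurableSet_Ioo hder hinj
    (levelDensity V F E)
  rw [arg_image_Ioo hl hV hqM hE] at h_int hval
  constructor
  · rw [intervalIntegrable_iff_integrableOn_Ioo_of_le (by linarith)]
    have := (h_int (hc.integrableOn_Icc.mono_set Set.Ioo_subset_Icc_self)).congr_fun hpt
      measurableSet_Ioo
    have := this.mul_const 2
    simpa only [IntegrableOn, mul_assoc, inv_mul_cancel₀ (two_ne_zero (α := ℝ)), mul_one] using this
  · rw [integral_of_le (by linarith), integral_of_le Real.pi_pos.le, integral_Ioc_eq_integral_Ioo,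
      integral_Ioc_eq_integral_Ioo, hval, setIntegral_congr_fun measurableSet_Ioo hpt,
      MeasureTheory.integral_mul_const]
    ring

lemma integral_level_eq (hl : 1 ≤ l) (hV : GoodPotential l V)
    (hqM : IsTurningPoint V qM) (hE : V 0 < E) (hc : Continuous (levelDensity V F E))
    (hg : ∀ x ξ, ham V x ξ = E → vir V x ξ * F x ξ = g x ξ) :
    IntervalIntegrable (fun q => (g q √(E - V q) + g q (-√(E - V q))) / √(E - V q)) volume
        (-(qM E)) (qM E) ∧
      ∫ q in (-(qM E))..(qM E), (g q √(E - V q) + g q (-√(E - V q))) / √(E - V q)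
        = 2 * levelIntegral V F E := by
  have hneg (θ : ℝ) : levelDensity V (fun x ξ => F x (-ξ)) E θ = levelDensity V F E (-θ) := by
    simp [levelDensity, polarRadius_neg]
  have hc' : Continuous (levelDensity V (fun x ξ => F x (-ξ)) E) := by
    rw [funext hneg]; exact hc.comp continuous_neg
  obtain ⟨i1, e1⟩ := integral_levelDensity_zero_pi hl hV hqM hE hc hg
  obtain ⟨i2, e2⟩ := integral_levelDensity_zero_pi (g := fun x ξ => g x (-ξ)) hl hV hqM hE hc'
    fun x ξ h => by
      rw [← hg x (-ξ) (by rw [← h]; simp [ham])]; simp [vir]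
  simp only [add_div]
  refine ⟨i1.add i2, ?_⟩
  rw [intervalIntegral.integral_add i1 i2, e1, e2, levelIntegral,
    ← integral_add_adjacent_intervals (hc.intervalIntegrable (-π) 0) (hc.intervalIntegrable 0 π)]
  simp only [hneg]
  rw [integral_comp_neg (fun t => levelDensity V F E t), neg_zero]
  ring

lemma period_eq (hl : 1 ≤ l) (hV : GoodPotential l V)
    (hqM : IsTurningPoint V qM) (hE : V 0 < E) (hc : Continuous (levelDensity V F E))
    (hg : ∀ x ξ, ham V x ξ = E → vir V x ξ * F x ξ = 1) :
    period V qM E = 2 * levelIntegral V F E := by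
  obtain ⟨hQ, -, -⟩ := hqM E hE
  obtain ⟨hi, he⟩ := integral_level_eq (g := fun _ _ => 1) hl hV hqM hE hc hg
  have hi1 := hi.mono_set (c := -(qM E)) (d := 0) (Set.uIcc_subset_uIcc Set.left_mem_uIcc
    (Set.mem_uIcc.2 (Or.inl ⟨by linarith, hQ.le⟩)))
  have hi2 := hi.mono_set (c := 0) (d := qM E) (Set.uIcc_subset_uIcc
    (Set.mem_uIcc.2 (Or.inl ⟨by linarith, hQ.le⟩)) Set.right_mem_uIcc)
  rw [← he, ← integral_add_adjacent_intervals hi1 hi2]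
  have hsymm : ∫ q in (-(qM E))..0, ((1 : ℝ) + 1) / √(E - V q)
      = ∫ q in (0 : ℝ)..(qM E), (1 + 1) / √(E - V q) := by
    have := integral_comp_neg (a := 0) (b := qM E) fun q => ((1 : ℝ) + 1) / √(E - V q)
    simp only [hV.even, neg_zero] at this
    exact this.symm
  rw [hsymm, period]
  simp only [div_eq_mul_inv, intervalIntegral.integral_const_mul]
  ring

end TurningPoint

/-! ### Orbit averages and the homological equation -/

section Homological

variable {l : ℝ} {V qM : ℝ → ℝ} {a b c m E₀ : ℝ} {f p : ℝ → ℝ → ℝ}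

lemma orbitAvg_eq_zero {E : ℝ} (h0 : ∀ x ξ, ham V x ξ ≤ E₀ → p x ξ = 0) (hE : E ≤ E₀) :
    orbitAvg V qM p E = 0 := by
  have h : ∀ q, (p q √(E - V q) + p q (-√(E - V q))) / √(E - V q) = 0 := fun q => by
    rcases le_or_gt (E - V q) 0 with hq | hq
    · rw [Real.sqrt_eq_zero_of_nonpos hq, div_zero]
    · have hs : √(E - V q) ^ 2 + V q = E := by rw [Real.sq_sqrt hq.le]; ring
      rw [h0 _ _ ((hs.trans_le hE : _)), h0 _ _ (by rw [ham, neg_sq]; exact hs.trans_le hE)]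
      simp
  simp [orbitAvg, h]

/-- The weight whose level integrals are half the periods, cut off near the equilibrium. -/
def periodDensity (V : ℝ → ℝ) (a b c x ξ : ℝ) : ℝ :=
  energyCutoff b c (ham V x ξ) * (virMod V a b x ξ)⁻¹

lemma isSymbol_periodDensity (hl : 1 ≤ l) (hV : GoodPotential l V) (ha : V 0 < a) (hab : a < b)
    (hbc : b < c) : IsSymbol l (-(2 * l)) 0 (periodDensity V a b c) := by
  have h1 : IsSymbol l 0 0 fun x ξ => energyCutoff b c (ham V x ξ) := by
    have := (isSymbol_const 1).add ((isSymbol_const (-1)).mul hl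
      ((isSymbol_one_sub_energyCutoff hl hV hbc 0 0).mono hl (m' := 0) (n' := 0) le_rfl le_rfl)
        |>.mono hl (m' := 0) (n' := 0) (by simp) (by simp))
    simpa using this
  exact (h1.mul hl (isSymbol_virMod_inv hl hV ha hab)).mono hl (by simp) (by simp)

lemma periodDensity_eq_zero (hbc : b < c) {x ξ : ℝ} (h : ham V x ξ < b) :
    periodDensity V a b c x ξ = 0 := by
  rw [periodDensity, energyCutoff_of_le hbc h.le, zero_mul]

lemma periodDensity_eq (hbc : b < c) {x ξ : ℝ} (h : c ≤ ham V x ξ) :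
    periodDensity V a b c x ξ = (virMod V a b x ξ)⁻¹ := by
  rw [periodDensity, energyCutoff_of_ge hbc h, one_mul]

lemma virMod_pos (hl : 1 ≤ l) (hV : GoodPotential l V) (ha : V 0 < a) (hab : a < b) (x ξ : ℝ) :
    0 < virMod V a b x ξ := by
  obtain ⟨k, hk, h⟩ := exists_lower_bound_virMod hl hV ha hab
  exact (mul_pos hk (wt_pos hl _ _ _ _)).trans_le (h x ξ)

/-- A positive modification of half the period, as a function of the energy. -/
def halfPeriod (V : ℝ → ℝ) (a b c E₀ E : ℝ) : ℝ :=
  levelIntegral V (periodDensity V a b c) E + (1 - energyCutoff c E₀ E)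

lemma exists_lower_bound_halfPeriod (hl : 1 ≤ l) (hV : GoodPotential l V) (ha : V 0 < a)
    (hab : a < b) (hbc : b < c) (hc : c < E₀) :
    ∃ k, 0 < k ∧ ∀ x ξ, k * wt l (1 - l) 0 x ξ ≤ halfPeriod V a b c E₀ (ham V x ξ) := by
  have hb := ha.trans hab
  have hs := isSymbol_periodDensity hl hV ha hab hbc
  have hcont := continuous_levelDensity hl hV hb hs.smooth
    fun x ξ h => periodDensity_eq_zero (a := a) hbc h
  obtain ⟨C, hC⟩ := ((isSymbol_virMod (a := a) hl hV hab).sym 0).bound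
  have hC0 : 0 < C := pos_of_mul_pos_left
    ((abs_pos.2 (virMod_pos hl hV ha hab 0 0).ne').trans_le (hC 0 0)) (wt_pos hl _ _ _ _).le
  obtain ⟨k, hk, h⟩ := exists_lower_bound_levelIntegral (m := -(2 * l)) hl hV (hb.trans hbc) hcont
    (inv_pos.2 hC0) fun x ξ h => by
      rw [periodDensity_eq hbc h, ← neg_zero, ← wt_inv hl, ← mul_inv]
      exact inv_anti₀ (virMod_pos hl hV ha hab x ξ) ((le_abs_self _).trans (hC x ξ))
  rw [show -(2 * l) + l + 1 = 1 - l by ring] at h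
  refine exists_lower_bound_of_energyCutoff hl hV hc (fun x ξ => ?_) hk h
  refine intervalIntegral.integral_nonneg (by linarith [Real.pi_pos]) fun θ _ => ?_
  exact mul_nonneg (mul_nonneg (Real.smoothTransition.nonneg _)
    (inv_nonneg.2 (virMod_pos hl hV ha hab _ _).le)) (sq_nonneg _)

lemma isSymbol_halfPeriod_inv (hl : 1 ≤ l) (hV : GoodPotential l V) (ha : V 0 < a)
    (hab : a < b) (hbc : b < c) (hc : c < E₀) :
    IsSymbol l (l - 1) 0 fun x ξ => (halfPeriod V a b c E₀ (ham V x ξ))⁻¹ := by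
  obtain ⟨k, hk, h⟩ := exists_lower_bound_halfPeriod hl hV ha hab hbc hc
  have h1 := isSymbol_levelIntegral hl hV ha hab (isSymbol_periodDensity hl hV ha hab hbc)
    fun x ξ h => periodDensity_eq_zero (a := a) hbc h
  rw [show -(2 * l) + l + 1 = 1 - l by ring] at h1
  simpa [halfPeriod] using (h1.add (isSymbol_one_sub_energyCutoff hl hV hc _ _)).inv hl hk h

lemma exists_isSymbol_orbitAvg (hl : 1 ≤ l) (hV : GoodPotential l V) (hqM : IsTurningPoint V qM)
    (ha : V 0 < a) (hab : a < b) (hb : b < E₀) (hp : IsSymbol l m 0 p)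
    (h0 : ∀ x ξ, ham V x ξ < E₀ → p x ξ = 0) :
    ∃ A : ℝ → ℝ, IsSymbol l m 0 (fun x ξ => A (ham V x ξ)) ∧ (∀ E < E₀, A E = 0) ∧
      (∀ E, E₀ ≤ E → A E = orbitAvg V qM p E) ∧
      ∀ E, levelIntegral V (fun x ξ => (A (ham V x ξ) - p x ξ) * (virMod V a b x ξ)⁻¹) E = 0 := by
  obtain ⟨c, hbc, hc⟩ := exists_between hb
  have hVb := ha.trans hab
  set F : ℝ → ℝ → ℝ := fun x ξ => p x ξ * (virMod V a b x ξ)⁻¹ with hF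
  have hFs : IsSymbol l (m - 2 * l) 0 F :=
    (hp.mul hl (isSymbol_virMod_inv hl hV ha hab)).mono hl (by linarith) (by linarith)
  have hF0 : ∀ x ξ, ham V x ξ < E₀ → F x ξ = 0 := fun x ξ h => by simp [hF, h0 x ξ h]
  have hws := isSymbol_periodDensity hl hV ha hab hbc
  have hFc (E : ℝ) := (continuous_levelDensity hl hV (hVb.trans hb) hFs.smooth hF0).uncurry_left E
  have hwc (E : ℝ) := (continuous_levelDensity hl hV hVb hws.smooth
    fun x ξ h => periodDensity_eq_zero (a := a) hbc h).uncurry_left E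
  have hhalf {E : ℝ} (hE : E₀ ≤ E) :
      halfPeriod V a b c E₀ E = levelIntegral V (periodDensity V a b c) E := by
    rw [halfPeriod, energyCutoff_of_ge hc hE, sub_self, add_zero]
  have hpos {E : ℝ} (hE : E₀ ≤ E) : 0 < halfPeriod V a b c E₀ E := by
    obtain ⟨k, hk, h⟩ := exists_lower_bound_halfPeriod hl hV ha hab hbc hc
    rw [← (polarRadius_spec hl hV ((hVb.trans hb).trans_le hE) 0).2]
    exact (mul_pos hk (wt_pos hl _ _ _ _)).trans_le (h _ _)
  refine ⟨fun E => levelIntegral V F E * (halfPeriod V a b c E₀ E)⁻¹, ?_, fun E hE => ?_,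
    fun E hE => ?_, fun E => ?_⟩
  · exact ((isSymbol_levelIntegral hl hV ha hab hFs fun x ξ h => hF0 x ξ (h.trans hb)).mul hl
      (isSymbol_halfPeriod_inv hl hV ha hab hbc hc)).mono hl (by linarith) (by linarith)
  · simp [levelIntegral, levelDensity_eq_zero hl hV hF0 hE]
  · have hVE := (hVb.trans hb).trans_le hE
    beta_reduce
    rw [orbitAvg, (integral_level_eq (F := F) hl hV hqM hVE (hFc E) fun x ξ h => ?_).2,
      period_eq hl hV hqM hVE (hwc E) fun x ξ h => ?_, hhalf hE, mul_inv]
    · ring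
    · have hv := vir_pos hl hV (hVE.trans_eq h.symm)
      rw [periodDensity_eq hbc (h.symm ▸ hc.le.trans hE),
        virMod_eq hab (h.symm ▸ hb.le.trans hE), mul_inv_cancel₀ hv.ne']
    · have hv := vir_pos hl hV (hVE.trans_eq h.symm)
      simp only [hF]
      rw [virMod_eq hab (h.symm ▸ hb.le.trans hE)]
      field_simp
  · rcases lt_or_ge E E₀ with hE | hE
    · rw [levelIntegral, integral_congr fun θ _ => levelDensity_eq_zero (b := E₀) hl hV ?_ hE θ,
        intervalIntegral.integral_zero]
      intro x ξ h
      simp [levelIntegral, levelDensity_eq_zero hl hV hF0 h, h0 x ξ h]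
    · have hVE := (hVb.trans hb).trans_le hE
      have hpt (θ : ℝ) : levelDensity V (fun x ξ => (levelIntegral V F (ham V x ξ) *
          (halfPeriod V a b c E₀ (ham V x ξ))⁻¹ - p x ξ) * (virMod V a b x ξ)⁻¹) E θ
          = levelIntegral V F E * (halfPeriod V a b c E₀ E)⁻¹ *
            levelDensity V (periodDensity V a b c) E θ - levelDensity V F E θ := by
        have hr := (polarRadius_spec hl hV hVE θ).2
        simp only [levelDensity, hr, hF]
        rw [periodDensity_eq hbc (hr.symm ▸ hc.le.trans hE)]
        ring
      rw [levelIntegral]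
      simp only [hpt]
      rw [intervalIntegral.integral_sub (((hwc E).const_mul _).intervalIntegrable _ _)
        ((hFc E).intervalIntegrable _ _), intervalIntegral.integral_const_mul]
      change _ * levelIntegral V (periodDensity V a b c) E - levelIntegral V F E = 0
      rw [← hhalf hE, mul_assoc, inv_mul_cancel₀ (hpos hE).ne', mul_one, sub_self]

lemma exists_pbr_eq (hl : 1 ≤ l) (hV : GoodPotential l V) (ha : V 0 < a) (hab : a < b)
    (hf : IsSymbol l m 0 f) (h0 : ∀ x ξ, ham V x ξ < b → f x ξ = 0)
    (hJ : ∀ E, levelIntegral V (fun x ξ => f x ξ * (virMod V a b x ξ)⁻¹) E = 0) :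
    ∃ χ, IsSymbol l (m - l + 1) 0 χ ∧ IsSymbol l (m - l) 0 (dX χ) ∧
      (∀ x ξ, ham V x ξ < b → χ x ξ = 0) ∧ ∀ x ξ, pbr (ham V) χ x ξ = f x ξ := by
  set F : ℝ → ℝ → ℝ := fun x ξ => f x ξ * (virMod V a b x ξ)⁻¹ with hF
  have hFs : IsSymbol l (m - 2 * l) 0 F :=
    (hf.mul hl (isSymbol_virMod_inv hl hV ha hab)).mono hl (by linarith) (by linarith)
  have hF0 : ∀ x ξ, ham V x ξ < b → F x ξ = 0 := fun x ξ h => by simp [hF, h0 x ξ h]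
  obtain ⟨h1, h2⟩ := isSymbol_anglePrimitive hl hV ha hab hFs hF0 hJ
  refine ⟨anglePrimitive V F, h1.mono hl (by linarith) (by linarith),
    h2.mono hl (by linarith) (by linarith), fun x ξ h => ?_, fun x ξ => ?_⟩
  · simp [anglePrimitive, levelDensity_eq_zero hl hV hF0 h]
  · have hχ := hasFDerivAt_anglePrimitive hl hV ha hab hFs.smooth
      (isSymbol_eulerOp hl hV ha hab hFs).smooth hF0 hJ x ξ
    have hh := hasFDerivAt_ham hV x ξ
    have hfv : f x ξ = vir V x ξ * F x ξ := by
      rcases lt_or_ge (ham V x ξ) b with h | h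
      · rw [hF0 x ξ h, h0 x ξ h, mul_zero]
      · have := virMod_pos hl hV ha hab x ξ
        simp only [hF]
        rw [virMod_eq hab h] at this ⊢
        field_simp
    rw [pbr, hh.hasDerivAt_fst.deriv, hh.hasDerivAt_snd.deriv, hχ.hasDerivAt_fst.deriv,
      hχ.hasDerivAt_snd.deriv, hfv, vir]
    ring

end Homological

/-- solution of the homological equation `p + {h₀;χ} = ⟨p⟩∘h₀`, with
`χ ∈ S^{m₁+[m₂]-l+1,0}`, `∂_xχ ∈ S^{m₁+[m₂]-l,0}`, `χ` vanishing below some energy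
`E₀' > V 0`; here `⟨p⟩` is extended by `0` for `E ≤ V 0`. -/
theorem stmt1 (l : ℝ) (hl : 1 ≤ l) (V : ℝ → ℝ) (hV : GoodPotential l V)
    (qM : ℝ → ℝ) (hqM : IsTurningPoint V qM)
    (m₁ m₂ : ℝ) (p : ℝ → ℝ → ℝ) (hp : IsSymbol l m₁ m₂ p)
    (E₀ : ℝ) (hE₀ : V 0 < E₀)
    (hvan : ∀ x ξ : ℝ, ξ ^ 2 + V x ≤ E₀ → p x ξ = 0) :
    ∃ χ : ℝ → ℝ → ℝ,
      IsSymbol l (m₁ + max m₂ 0 - l + 1) 0 χ ∧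
      IsSymbol l (m₁ + max m₂ 0 - l) 0 (fun x ξ => deriv (fun x' => χ x' ξ) x) ∧
      (∃ E₀' : ℝ, V 0 < E₀' ∧ ∀ x ξ : ℝ, ξ ^ 2 + V x ≤ E₀' → χ x ξ = 0) ∧
      ∀ x ξ : ℝ,
        p x ξ + pbr (fun x' ξ' => ξ' ^ 2 + V x') χ x ξ
          = if V 0 < ξ ^ 2 + V x then orbitAvg V qM p (ξ ^ 2 + V x) else 0 := by
  have hp' : IsSymbol l (m₁ + max m₂ 0) 0 p :=
    hp.mono hl (by linarith [le_max_right m₂ 0]) (by linarith [le_max_left m₂ 0])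
  obtain ⟨b, hVb, hb⟩ := exists_between hE₀
  obtain ⟨a, ha, hab⟩ := exists_between hVb
  obtain ⟨A, hA, hA0, hAavg, hJ⟩ := exists_isSymbol_orbitAvg hl hV hqM ha hab hb hp'
    fun x ξ h => hvan x ξ h.le
  have hf : IsSymbol l (m₁ + max m₂ 0) 0 fun x ξ => A (ham V x ξ) - p x ξ := by
    have := hA.add (((isSymbol_const (-1)).mul hl hp').mono hl (m' := m₁ + max m₂ 0) (n' := 0)
      (by linarith) (by linarith))
    simpa [sub_eq_add_neg] using this
  obtain ⟨χ, h1, h2, h3, h4⟩ := exists_pbr_eq hl hV ha hab hf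
    (fun x ξ h => by rw [hA0 _ (h.trans hb), hvan x ξ (h.trans hb).le, sub_zero]) hJ
  refine ⟨χ, h1, h2, ⟨a, ha, fun x ξ h => h3 x ξ (h.trans_lt hab)⟩, fun x ξ => ?_⟩
  have h5 : p x ξ + pbr (fun x' ξ' => ξ' ^ 2 + V x') χ x ξ = A (ξ ^ 2 + V x) := by
    have : pbr (fun x' ξ' => ξ' ^ 2 + V x') χ x ξ = A (ξ ^ 2 + V x) - p x ξ := h4 x ξ
    rw [this]; ring
  rw [h5]
  rcases lt_or_ge (ξ ^ 2 + V x) E₀ with h | h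
  · rw [hA0 _ h, orbitAvg_eq_zero hvan h.le, ite_self]
  · rw [if_pos (hE₀.trans_le h), hAavg _ h]
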